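/- Ramanujan's series for 1/π holds: 1/π = (2√2/9801) · ∑_{n=0}^∞ (26390n + 1103) · (4n)! / ((n!)^4 · 396^{4n}). -/

import Mathlib

namespace RamanujanPi

open Complex Filter Topology
open ModularForm hiding eta
open scoped ModularForm
open scoped Real

/-- The Weber-type quotient `η(z) / η(2z)`. -/
noncomputable def weber (z : ℂ) : ℂ := η z / η (2 * z)

/-- The product `η(z) η(2z)`. -/
noncomputable def etaMul (z : ℂ) : ℂ := η z * η (2 * z)

/-- The Euler product `∏ (1 - q ^ n)`. -/
noncomputable def euler (q : ℂ) : ℂ := ∏' n : ℕ, (1 - q ^ (n + 1))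

/-- The product `∏ (1 - q ^ (2 n - 1))`, written as a quotient of Euler products. -/
noncomputable def eulerOdd (q : ℂ) : ℂ := euler q / euler (q ^ 2)

/-- The nome `exp (2 π i z)`. -/
noncomputable def nome (z : ℂ) : ℂ := cexp (2 * π * I * z)

lemma norm_nome (z : ℂ) : ‖nome z‖ = Real.exp (-(2 * π * z.im)) := by
  simp [nome, Complex.norm_exp]

lemma norm_nome_lt_one {z : ℂ} (hz : 0 < z.im) : ‖nome z‖ < 1 := by
  rw [norm_nome, Real.exp_lt_one_iff]
  have := Real.pi_pos
  nlinarith [mul_pos this hz]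

lemma nome_ne_zero (z : ℂ) : nome z ≠ 0 := Complex.exp_ne_zero _

lemma nome_two_mul (z : ℂ) : nome (2 * z) = nome z ^ 2 := by
  rw [nome, nome, ← Complex.exp_nat_mul]; congr 1; push_cast; ring

lemma eta_eq (z : ℂ) : η z = cexp (2 * π * I * z / 24) * euler (nome z) := by
  simp [ModularForm.eta, euler, nome, Function.Periodic.qParam, eta_q_eq_pow]

lemma euler_ne_zero {q : ℂ} (hq : ‖q‖ < 1) : euler q ≠ 0 := by
  rcases eq_or_ne q 0 with rfl | h0
  · simp [euler]
  · obtain ⟨z, hz⟩ : ∃ z, nome z = q :=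
      ⟨Complex.log q / (2 * π * I), by
        rw [nome, mul_div_cancel₀ _ two_pi_I_ne_zero, Complex.exp_log h0]⟩
    have him : 0 < z.im := by
      rw [← hz, norm_nome, Real.exp_lt_one_iff] at hq
      have := Real.pi_pos
      nlinarith
    have := eta_ne_zero (z := z) him
    rw [eta_eq, hz] at this
    exact right_ne_zero_of_mul this

lemma differentiableOn_euler : DifferentiableOn ℂ euler (Metric.ball 0 1) :=
  differentiableOn_tprod_one_sub_pow

lemma weber_eq (z : ℂ) : weber z = cexp (-(2 * π * I * z / 24)) * eulerOdd (nome z) := by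
  rw [weber, eta_eq, eta_eq, nome_two_mul, eulerOdd, Complex.exp_neg,
    show 2 * π * I * (2 * z) / 24 = 2 * π * I * z / 24 + 2 * π * I * z / 24 by ring,
    Complex.exp_add]
  have := Complex.exp_ne_zero (2 * π * I * z / 24)
  field_simp

lemma etaMul_eq (z : ℂ) :
    etaMul z = cexp (2 * π * I * z / 8) * (euler (nome z) * euler (nome z ^ 2)) := by
  rw [etaMul, eta_eq, eta_eq, nome_two_mul,
    show 2 * π * I * z / 8 = 2 * π * I * z / 24 + 2 * π * I * (2 * z) / 24 by ring, Complex.exp_add]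
  ring

lemma im_two_mul_pos {z : ℂ} (hz : 0 < z.im) : 0 < (2 * z).im := by simpa using hz

lemma weber_ne_zero {z : ℂ} (hz : 0 < z.im) : weber z ≠ 0 :=
  div_ne_zero (eta_ne_zero hz) (eta_ne_zero (im_two_mul_pos hz))

lemma etaMul_ne_zero {z : ℂ} (hz : 0 < z.im) : etaMul z ≠ 0 :=
  mul_ne_zero (eta_ne_zero hz) (eta_ne_zero (im_two_mul_pos hz))

lemma differentiableAt_weber {z : ℂ} (hz : 0 < z.im) : DifferentiableAt ℂ weber z :=
  (differentiableAt_eta_of_mem_upperHalfPlaneSet hz).div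
    ((differentiableAt_eta_of_mem_upperHalfPlaneSet (im_two_mul_pos hz)).comp z (by fun_prop))
    (eta_ne_zero (im_two_mul_pos hz))

lemma differentiableAt_etaMul {z : ℂ} (hz : 0 < z.im) : DifferentiableAt ℂ etaMul z :=
  (differentiableAt_eta_of_mem_upperHalfPlaneSet hz).mul
    ((differentiableAt_eta_of_mem_upperHalfPlaneSet (im_two_mul_pos hz)).comp z (by fun_prop))

lemma nome_add_int (z : ℂ) (n : ℤ) : nome (z + n) = nome z := by
  rw [nome, nome, mul_add, Complex.exp_add, mul_comm (2 * π * I) (n : ℂ), exp_int_mul_two_pi_mul_I,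
    mul_one]

lemma weber_add_int (z : ℂ) (n : ℤ) :
    weber (z + n) = cexp (2 * π * I / 24 * (-n : ℤ)) * weber z := by
  rw [weber_eq, weber_eq, nome_add_int, ← mul_assoc, ← Complex.exp_add]
  congr 2; push_cast; ring

lemma etaMul_add_one (z : ℂ) : etaMul (z + 1) = cexp (2 * π * I / 8) * etaMul z := by
  have := nome_add_int z 1
  rw [Int.cast_one] at this
  rw [etaMul_eq, etaMul_eq, this,
    show 2 * π * I * (z + 1) / 8 = 2 * π * I / 8 + 2 * π * I * z / 8 by ring, Complex.exp_add]
  ring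

lemma im_neg_one_div {z : ℂ} (hz : 0 < z.im) : 0 < (-1 / z).im := by
  have h : z ≠ 0 := by rintro rfl; simp at hz
  rw [neg_div, one_div, Complex.neg_im, Complex.inv_im, neg_div, neg_neg]
  exact div_pos hz (Complex.normSq_pos.2 h)

lemma eta_neg_one_div {z : ℂ} (hz : 0 < z.im) :
    η (-1 / z) = (sqrt I)⁻¹ * (sqrt z * η z) := by
  simpa using eta_comp_eq_csqrt_I_inv hz

lemma sqrt_two_mul {z : ℂ} (hz : z ≠ 0) : sqrt (2 * z) = (√2 : ℝ) * sqrt z := by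
  have h2 : ((2 : ℝ) : ℂ) * z ≠ 0 := by simpa using hz
  rw [show (2 : ℂ) * z = ((2 : ℝ) : ℂ) * z by norm_num, sqrt_eq_exp h2, sqrt_eq_exp hz,
    Complex.log_ofReal_mul two_pos hz, add_div, Complex.exp_add, ← Real.exp_log (x := √2) (by simp),
    Real.log_sqrt zero_le_two]
  simp

lemma sqrt_mul_self {z : ℂ} (hz : z ≠ 0) : sqrt z * sqrt z = z := by
  rw [sqrt_eq_exp hz, ← Complex.exp_add, add_halves, Complex.exp_log hz]

lemma weber_fricke {z : ℂ} (hz : 0 < z.im) : weber (-1 / (2 * z)) = (√2 : ℝ) / weber z := by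
  have h0 : z ≠ 0 := by rintro rfl; simp at hz
  have h2 := im_two_mul_pos hz
  have hI : sqrt I ≠ 0 := by simp [sqrt]
  have hs : sqrt z ≠ 0 := by simp [sqrt, h0]
  have e1 := eta_ne_zero hz
  have e2 := eta_ne_zero h2
  rw [weber, weber, eta_neg_one_div h2, show 2 * (-1 / (2 * z)) = -1 / z by field_simp,
    eta_neg_one_div hz, sqrt_two_mul h0]
  field_simp

lemma etaMul_fricke {z : ℂ} (hz : 0 < z.im) :
    etaMul (-1 / (2 * z)) = (√2 : ℝ) / I * z * etaMul z := by
  have h0 : z ≠ 0 := by rintro rfl; simp at hz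
  have h2 := im_two_mul_pos hz
  rw [etaMul, etaMul, eta_neg_one_div h2, show 2 * (-1 / (2 * z)) = -1 / z by field_simp,
    eta_neg_one_div hz, sqrt_two_mul h0]
  calc _ = (√2 : ℝ) * (sqrt I * sqrt I)⁻¹ * (sqrt z * sqrt z) * (η z * η (2 * z)) := by ring
    _ = _ := by rw [sqrt_mul_self I_ne_zero, sqrt_mul_self h0]; ring

lemma norm_add_int {G : ℂ → ℂ} (hT : ∀ z, 0 < z.im → ‖G (z + 1)‖ = ‖G z‖) {z : ℂ}
    (hz : 0 < z.im) (n : ℤ) : ‖G (z + n)‖ = ‖G z‖ := by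
  induction n with
  | zero => simp
  | succ n ih =>
    rw [← ih]
    convert hT (z + (n : ℤ)) (by simpa using hz) using 2
    push_cast; ring_nf
  | pred n ih =>
    rw [← ih]
    convert (hT (z + (-n - 1 : ℤ)) (by simpa using hz)).symm using 2
    push_cast; ring_nf

/-- Maximum modulus principle for a holomorphic function on the upper half-plane which decays at
`i∞` and whose modulus is determined by its values on a horizontal half-plane. -/
lemma eq_zero_of_reduction {G : ℂ → ℂ} (hG : ∀ z, 0 < z.im → DifferentiableAt ℂ G z)
    (hT : ∀ z, 0 < z.im → ‖G (z + 1)‖ = ‖G z‖)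
    (hinf : Tendsto G (comap im atTop) (𝓝 0)) {c : ℝ} (hc : 0 < c)
    (hred : ∀ z, 0 < z.im → ∃ z', c ≤ z'.im ∧ ‖G z'‖ = ‖G z‖) {z : ℂ} (hz : 0 < z.im) :
    G z = 0 := by
  by_contra hne
  have hpos : 0 < ‖G z‖ := norm_pos_iff.2 hne
  have hev : ∀ᶠ w in comap im atTop, ‖G w‖ < ‖G z‖ / 2 := by
    filter_upwards [hinf.eventually (Metric.ball_mem_nhds 0 (half_pos hpos))] with w hw
    simpa using hw
  obtain ⟨Y, hY⟩ : ∃ Y : ℝ, ∀ w : ℂ, Y ≤ w.im → ‖G w‖ < ‖G z‖ / 2 := by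
    rw [eventually_comap, eventually_atTop] at hev
    obtain ⟨Y, hY⟩ := hev
    exact ⟨Y, fun w hw => hY w.im hw w rfl⟩
  set K : Set ℂ := Set.Icc 0 1 ×ℂ Set.Icc c (max c Y) with hK
  have hKc : IsCompact K := isCompact_Icc.reProdIm isCompact_Icc
  have hKim : ∀ w ∈ K, 0 < w.im := fun w hw => hc.trans_le hw.2.1
  have hcont : ContinuousOn (fun w => ‖G w‖) K := fun w hw =>
    ((hG w (hKim w hw)).continuousAt.norm).continuousWithinAt
  obtain ⟨m, hmK, hm⟩ := hKc.exists_isMaxOn ⟨0 + c * I, by simp [hK, mem_reProdIm]⟩ hcont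
  have key : ∀ w, 0 < w.im → ‖G w‖ ≤ ‖G m‖ ∨ ‖G w‖ < ‖G z‖ / 2 := by
    intro w hw
    obtain ⟨w', hw', hw'2⟩ := hred w hw
    rcases le_total Y w'.im with h | h
    · right; rw [← hw'2]; exact hY _ h
    · left
      rw [← hw'2, ← norm_add_int hT (hc.trans_le hw') (-⌊w'.re⌋)]
      refine hm ?_
      simp only [hK, mem_reProdIm, Set.mem_Icc]
      have h1 := Int.floor_le w'.re
      have h2 := Int.lt_floor_add_one w'.re
      refine ⟨⟨?_, ?_⟩, ?_, ?_⟩ <;> simp <;> first | linarith | (right; linarith)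
  have hzm : ‖G z‖ ≤ ‖G m‖ := by rcases key z hz with h | h <;> linarith
  have hmax : IsMaxOn (norm ∘ G) {w | 0 < w.im} m := fun w hw => by
    rcases key w hw with h | h
    · exact h
    · simp only [Set.mem_ofPred_eq, Function.comp]; linarith
  have := Complex.norm_eqOn_of_isPreconnected_of_isMaxOn (convex_halfSpace_im_gt 0).isPreconnected
    (isOpen_lt continuous_const continuous_im)
    (fun w hw => (hG w hw).differentiableWithinAt) (hKim m hmK) hmax
  have h1 := this (show (max 1 Y : ℝ) * I ∈ {w : ℂ | 0 < w.im} by simp)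
  have h2 := hY ((max 1 Y : ℝ) * I) (by simp)
  simp only [Function.comp, Function.const_apply] at h1
  linarith

lemma exists_reduction_of_fricke {G : ℂ → ℂ}
    (hT : ∀ z, 0 < z.im → ‖G (z + 1)‖ = ‖G z‖)
    (hw : ∀ z, 0 < z.im → ‖G (-1 / (2 * z))‖ = ‖G z‖) (z : ℂ) (hz : 0 < z.im) :
    ∃ z', 2 / 5 ≤ z'.im ∧ ‖G z'‖ = ‖G z‖ := by
  have main : ∀ n : ℕ, ∀ z : ℂ, 0 < z.im → 2 / 5 * (41 / 50 : ℝ) ^ n ≤ z.im →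
      ∃ z', 2 / 5 ≤ z'.im ∧ ‖G z'‖ = ‖G z‖ := by
    intro n
    induction n with
    | zero => intro z _ h; exact ⟨z, by simpa using h, rfl⟩
    | succ n ih =>
      intro z hz h
      rcases le_or_gt (2 / 5) z.im with h5 | h5
      · exact ⟨z, h5, rfl⟩
      set z₁ : ℂ := z + (-round z.re : ℤ) with hz₁
      have him : z₁.im = z.im := by simp [hz₁]
      have hre : |z₁.re| ≤ 1 / 2 := by
        simpa [hz₁, ← sub_eq_add_neg] using abs_sub_round z.re
      have hz₁' : 0 < z₁.im := by rwa [him]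
      have hw' : (-1 / (2 * z₁)).im = z.im / (2 * (z₁.re ^ 2 + z.im ^ 2)) := by
        rw [← him, show -1 / (2 * z₁) = -(2 * z₁)⁻¹ by rw [neg_div, one_div], Complex.neg_im,
          Complex.inv_im, Complex.normSq_apply]
        have : z₁.re ^ 2 + z₁.im ^ 2 ≠ 0 := by positivity
        have h' : (2 * z₁).re * (2 * z₁).re + (2 * z₁).im * (2 * z₁).im
          = 4 * (z₁.re ^ 2 + z₁.im ^ 2) := by simp; ring
        rw [h']
        simp
        field_simp
        norm_num
      have hden : 2 * (z₁.re ^ 2 + z.im ^ 2) ≤ 41 / 50 := by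
        have := sq_le_sq' (abs_le.1 hre).1 (abs_le.1 hre).2
        nlinarith
      have hden0 : 0 < 2 * (z₁.re ^ 2 + z.im ^ 2) := by positivity
      obtain ⟨z', h1, h2⟩ := ih (-1 / (2 * z₁)) (by rw [hw']; positivity) (by
        rw [hw', le_div_iff₀ hden0]
        calc _ ≤ 2 / 5 * (41 / 50 : ℝ) ^ n * (41 / 50) := by gcongr
          _ ≤ _ := by rw [pow_succ] at h; linarith)
      exact ⟨z', h1, by rw [h2, hw _ hz₁', hz₁, norm_add_int hT hz]⟩
  obtain ⟨n, hn⟩ := exists_pow_lt_of_lt_one (y := (41 / 50 : ℝ)) (x := z.im / (2 / 5))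
    (by positivity) (by norm_num)
  refine main n z hz ?_
  rw [lt_div_iff₀ (by norm_num)] at hn
  linarith

/-- The product `∏ (1 - q ^ n) (1 - q ^ (2 n))`. -/
noncomputable def eulerMul (q : ℂ) : ℂ := euler q * euler (q ^ 2)

/-- The weight two form `-24 q d/dq log (η(z) / η(2z))` as a function of the nome. -/
noncomputable def dlogWeber (q : ℂ) : ℂ := 1 - 24 * q * deriv eulerOdd q / eulerOdd q

/-- The quasimodular form `24 q d/dq log (η(z) η(2z))` as a function of the nome. -/
noncomputable def dlogEtaMul (q : ℂ) : ℂ := 3 + 24 * q * deriv eulerMul q / eulerMul q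

lemma sq_mem_ball {q : ℂ} (hq : q ∈ Metric.ball (0 : ℂ) 1) : q ^ 2 ∈ Metric.ball (0 : ℂ) 1 := by
  simp only [mem_ball_zero_iff, norm_pow] at *
  exact pow_lt_one₀ (norm_nonneg q) hq two_ne_zero

lemma euler_sq_ne_zero {q : ℂ} (hq : q ∈ Metric.ball (0 : ℂ) 1) : euler (q ^ 2) ≠ 0 :=
  euler_ne_zero (mem_ball_zero_iff.1 (sq_mem_ball hq))

lemma differentiableOn_euler_sq : DifferentiableOn ℂ (fun q => euler (q ^ 2)) (Metric.ball 0 1) :=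
  differentiableOn_euler.comp (by fun_prop) fun _ => sq_mem_ball

lemma eulerOdd_ne_zero {q : ℂ} (hq : q ∈ Metric.ball (0 : ℂ) 1) : eulerOdd q ≠ 0 :=
  div_ne_zero (euler_ne_zero (mem_ball_zero_iff.1 hq)) (euler_sq_ne_zero hq)

lemma eulerMul_ne_zero {q : ℂ} (hq : q ∈ Metric.ball (0 : ℂ) 1) : eulerMul q ≠ 0 :=
  mul_ne_zero (euler_ne_zero (mem_ball_zero_iff.1 hq)) (euler_sq_ne_zero hq)

lemma differentiableOn_eulerOdd : DifferentiableOn ℂ eulerOdd (Metric.ball 0 1) :=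
  differentiableOn_euler.div differentiableOn_euler_sq fun _ => euler_sq_ne_zero

lemma differentiableOn_eulerMul : DifferentiableOn ℂ eulerMul (Metric.ball 0 1) :=
  differentiableOn_euler.mul differentiableOn_euler_sq

lemma differentiableOn_dlogWeber : DifferentiableOn ℂ dlogWeber (Metric.ball 0 1) := by
  have h := differentiableOn_eulerOdd.deriv Metric.isOpen_ball
  exact ((((differentiableOn_id.const_mul 24).mul h).div differentiableOn_eulerOdd
    fun _ => eulerOdd_ne_zero).const_sub 1)

lemma differentiableOn_dlogEtaMul : DifferentiableOn ℂ dlogEtaMul (Metric.ball 0 1) := by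
  have h := differentiableOn_eulerMul.deriv Metric.isOpen_ball
  exact ((((differentiableOn_id.const_mul 24).mul h).div differentiableOn_eulerMul
    fun _ => eulerMul_ne_zero).const_add 3)

lemma hasDerivAt_of_differentiableOn_ball {f : ℂ → ℂ} (hf : DifferentiableOn ℂ f (Metric.ball 0 1))
    {q : ℂ} (hq : q ∈ Metric.ball (0 : ℂ) 1) : HasDerivAt f (deriv f q) q :=
  (hf.differentiableAt (Metric.isOpen_ball.mem_nhds hq)).hasDerivAt

lemma nome_mem_ball {z : ℂ} (hz : 0 < z.im) : nome z ∈ Metric.ball (0 : ℂ) 1 :=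
  mem_ball_zero_iff.2 (norm_nome_lt_one hz)

lemma hasDerivAt_nome (z : ℂ) : HasDerivAt nome (2 * π * I * nome z) z := by
  have := ((hasDerivAt_id z).const_mul (2 * π * I)).cexp
  exact this.congr_deriv (by simp [nome, mul_comm])

lemma hasDerivAt_comp_nome {f : ℂ → ℂ} (hf : DifferentiableOn ℂ f (Metric.ball 0 1))
    {z : ℂ} (hz : 0 < z.im) :
    HasDerivAt (fun z => f (nome z)) (2 * π * I * (nome z * deriv f (nome z))) z := by
  have := (hasDerivAt_of_differentiableOn_ball hf (nome_mem_ball hz)).comp z (hasDerivAt_nome z)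
  exact this.congr_deriv (by ring)

lemma hasDerivAt_weber {z : ℂ} (hz : 0 < z.im) :
    HasDerivAt weber (-(2 * π * I / 24) * dlogWeber (nome z) * weber z) z := by
  have h1 : HasDerivAt (fun z : ℂ => cexp (-(2 * π * I * z / 24)))
      (cexp (-(2 * π * I * z / 24)) * (-(2 * π * I / 24))) z := by
    have := ((((hasDerivAt_id z).const_mul (2 * π * I)).div_const 24).neg).cexp
    simpa using this
  have := h1.mul (hasDerivAt_comp_nome differentiableOn_eulerOdd hz)
  have h0 := eulerOdd_ne_zero (nome_mem_ball hz)
  rw [show weber = fun z => cexp (-(2 * π * I * z / 24)) * eulerOdd (nome z) from funext weber_eq]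
  refine this.congr_deriv ?_
  simp only [dlogWeber]
  field_simp
  ring

lemma hasDerivAt_etaMul {z : ℂ} (hz : 0 < z.im) :
    HasDerivAt etaMul (2 * π * I / 24 * dlogEtaMul (nome z) * etaMul z) z := by
  have h1 : HasDerivAt (fun z : ℂ => cexp (2 * π * I * z / 8))
      (cexp (2 * π * I * z / 8) * (2 * π * I / 8)) z := by
    have := (((hasDerivAt_id z).const_mul (2 * π * I)).div_const 8).cexp
    simpa using this
  have := h1.mul (hasDerivAt_comp_nome differentiableOn_eulerMul hz)
  have h0 := eulerMul_ne_zero (nome_mem_ball hz)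
  rw [show etaMul = fun z => cexp (2 * π * I * z / 8) * eulerMul (nome z) from funext etaMul_eq]
  refine this.congr_deriv ?_
  simp only [dlogEtaMul]
  field_simp
  ring

lemma im_fricke_pos {z : ℂ} (hz : 0 < z.im) : 0 < (-1 / (2 * z)).im :=
  im_neg_one_div (im_two_mul_pos hz)

lemma ne_zero_of_im_pos {z : ℂ} (hz : 0 < z.im) : z ≠ 0 := by rintro rfl; simp at hz

lemma hasDerivAt_fricke {z : ℂ} (hz : z ≠ 0) :
    HasDerivAt (fun z : ℂ => -1 / (2 * z)) (1 / (2 * z ^ 2)) z := by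
  have := (hasDerivAt_const z (-1 : ℂ)).fun_div ((hasDerivAt_id z).const_mul 2) (by simpa using hz)
  refine this.congr_deriv ?_
  simp; field_simp

lemma eventually_im_pos {z : ℂ} (hz : 0 < z.im) : ∀ᶠ w in 𝓝 z, 0 < w.im :=
  (isOpen_lt continuous_const continuous_im).mem_nhds hz

lemma dlogWeber_fricke {z : ℂ} (hz : 0 < z.im) :
    dlogWeber (nome (-1 / (2 * z))) = -(2 * z ^ 2) * dlogWeber (nome z) := by
  have h0 := ne_zero_of_im_pos hz
  have hu := weber_ne_zero hz
  have h1 := (hasDerivAt_weber (im_fricke_pos hz)).comp z (hasDerivAt_fricke h0)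
  have h2 := (hasDerivAt_const z ((√2 : ℝ) : ℂ)).fun_div (hasDerivAt_weber hz) hu
  have h3 := h1.unique (h2.congr_of_eventuallyEq
    ((eventually_im_pos hz).mono fun w hw => weber_fricke hw))
  rw [weber_fricke hz] at h3
  have hs : ((√2 : ℝ) : ℂ) ≠ 0 := by simp
  have hpi : (π : ℂ) ≠ 0 := by simp [Real.pi_ne_zero]
  generalize dlogWeber (nome (-1 / (2 * z))) = Zw at *
  have h4 : (π * I * (√2 : ℝ)) * (Zw - -(2 * z ^ 2) * dlogWeber (nome z)) = 0 := by
    field_simp at h3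
    linear_combination -h3
  have := (mul_eq_zero.1 h4).resolve_left (by simp [hpi])
  linear_combination this

lemma dlogEtaMul_fricke {z : ℂ} (hz : 0 < z.im) :
    dlogEtaMul (nome (-1 / (2 * z))) = 2 * z ^ 2 * dlogEtaMul (nome z) + 48 * z / (2 * π * I) := by
  have h0 := ne_zero_of_im_pos hz
  have hu := etaMul_ne_zero hz
  have h1 := (hasDerivAt_etaMul (im_fricke_pos hz)).comp z (hasDerivAt_fricke h0)
  have h2 := ((hasDerivAt_id z).const_mul ((√2 : ℝ) / I)).mul (hasDerivAt_etaMul hz)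
  have h3 := h1.unique (h2.congr_of_eventuallyEq
    ((eventually_im_pos hz).mono fun w hw => etaMul_fricke hw))
  rw [etaMul_fricke hz] at h3
  have hs : ((√2 : ℝ) : ℂ) ≠ 0 := by simp
  have hpi : (π : ℂ) ≠ 0 := by simp [Real.pi_ne_zero]
  simp only [id] at h3
  generalize dlogEtaMul (nome (-1 / (2 * z))) = Cw at *
  field_simp at h3 ⊢
  linear_combination 2 * h3

lemma nome_deriv_dlogEtaMul_fricke {z : ℂ} (hz : 0 < z.im) :
    nome (-1 / (2 * z)) * deriv dlogEtaMul (nome (-1 / (2 * z))) =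
      4 * z ^ 4 * (nome z * deriv dlogEtaMul (nome z)) +
        8 * z ^ 3 * dlogEtaMul (nome z) / (2 * π * I) + 96 * z ^ 2 / (2 * π * I) ^ 2 := by
  have h0 := ne_zero_of_im_pos hz
  have h1 := (hasDerivAt_comp_nome differentiableOn_dlogEtaMul (im_fricke_pos hz)).comp z
    (hasDerivAt_fricke h0)
  have h2 := ((((hasDerivAt_id z).pow 2).const_mul 2).mul
    (hasDerivAt_comp_nome differentiableOn_dlogEtaMul hz)).add
      (((hasDerivAt_id z).const_mul 48).div_const (2 * π * I))
  have h3 := h1.unique (h2.congr_of_eventuallyEq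
    ((eventually_im_pos hz).mono fun w hw => dlogEtaMul_fricke hw))
  have hpi : (π : ℂ) ≠ 0 := by simp [Real.pi_ne_zero]
  generalize nome (-1 / (2 * z)) * deriv dlogEtaMul (nome (-1 / (2 * z))) = Cw at *
  simp only [id, Pi.pow_apply] at h3
  push_cast at h3
  field_simp at h3 ⊢
  linear_combination 2 * h3

lemma nome_deriv_dlogWeber_fricke {z : ℂ} (hz : 0 < z.im) :
    nome (-1 / (2 * z)) * deriv dlogWeber (nome (-1 / (2 * z))) =
      -(4 * z ^ 4 * (nome z * deriv dlogWeber (nome z)) +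
        8 * z ^ 3 * dlogWeber (nome z) / (2 * π * I)) := by
  have h0 := ne_zero_of_im_pos hz
  have h1 := (hasDerivAt_comp_nome differentiableOn_dlogWeber (im_fricke_pos hz)).comp z
    (hasDerivAt_fricke h0)
  have h2 := ((((hasDerivAt_id z).pow 2).const_mul 2).neg.mul
    (hasDerivAt_comp_nome differentiableOn_dlogWeber hz))
  have h3 := h1.unique (h2.congr_of_eventuallyEq
    ((eventually_im_pos hz).mono fun w hw => dlogWeber_fricke hw))
  have hpi : (π : ℂ) ≠ 0 := by simp [Real.pi_ne_zero]
  generalize nome (-1 / (2 * z)) * deriv dlogWeber (nome (-1 / (2 * z))) = Cw at *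
  simp only [id, Pi.pow_apply, Pi.neg_apply] at h3
  push_cast at h3
  field_simp at h3 ⊢
  linear_combination 2 * h3

lemma tendsto_nome : Tendsto nome (comap im atTop) (𝓝 0) := by
  rw [tendsto_zero_iff_norm_tendsto_zero]
  simp_rw [norm_nome]
  refine Real.tendsto_exp_atBot.comp (tendsto_neg_atTop_atBot.comp ?_)
  exact tendsto_comap.const_mul_atTop (by positivity)

lemma tendsto_exp_mul_comp_nome {F : ℂ → ℂ} {k : ℕ}
    (hF : F =O[𝓝 0] fun q => q ^ (k + 1)) :
    Tendsto (fun z => cexp (-(2 * π * I * z * (k + 1 / 2))) * F (nome z)) (comap im atTop)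
      (𝓝 0) := by
  have h1 : (fun z => cexp (-(2 * π * I * z * (k + 1 / 2))) * F (nome z)) =O[comap im atTop]
      fun z => cexp (-(2 * π * I * z * (k + 1 / 2))) * nome z ^ (k + 1) :=
    (Asymptotics.isBigO_refl _ _).mul (hF.comp_tendsto tendsto_nome)
  refine h1.trans_tendsto ?_
  have h2 : (fun z => cexp (-(2 * π * I * z * (k + 1 / 2))) * nome z ^ (k + 1)) =
      fun z => nome (z / 2) := by
    ext z
    rw [nome, nome, ← Complex.exp_nat_mul, ← Complex.exp_add]
    congr 1; push_cast; ring
  rw [h2]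
  refine tendsto_nome.comp (tendsto_comap_iff.2 ?_)
  have : im ∘ (fun z : ℂ => z / 2) = fun z => z.im / 2 := by ext z; simp
  rw [this]
  exact tendsto_comap.atTop_div_const two_pos

lemma isBigO_of_differentiableAt {F : ℂ → ℂ} (hF : DifferentiableAt ℂ F 0) (h0 : F 0 = 0) :
    F =O[𝓝 0] fun q => q ^ (0 + 1) := by
  simpa [h0] using hF.isBigO_sub

lemma exp_half_turn_pow_four : cexp (2 * π * I / 8) ^ 4 = -1 := by
  rw [← Complex.exp_nat_mul, ← Complex.exp_pi_mul_I]; congr 1; push_cast; ring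

lemma weber_add_one_pow_twelve (z : ℂ) : weber (z + 1) ^ 12 = -weber z ^ 12 := by
  have := weber_add_int z 1
  rw [Int.cast_one] at this
  rw [this, mul_pow, ← Complex.exp_nat_mul]
  rw [show ((12 : ℕ) : ℂ) * (2 * π * I / 24 * (-1 : ℤ)) = -(π * I) by push_cast; ring,
    Complex.exp_neg, Complex.exp_pi_mul_I]
  norm_num

lemma etaMul_add_one_pow_four (z : ℂ) : etaMul (z + 1) ^ 4 = -etaMul z ^ 4 := by
  rw [etaMul_add_one, mul_pow, exp_half_turn_pow_four]; ring

lemma etaMul_fricke_pow_four {z : ℂ} (hz : 0 < z.im) :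
    etaMul (-1 / (2 * z)) ^ 4 = 4 * z ^ 4 * etaMul z ^ 4 := by
  have h2 : ((√2 : ℝ) : ℂ) ^ 4 = 4 := by
    rw [← Complex.ofReal_pow, show (√2 : ℝ) ^ 4 = 4 by
      rw [show (4 : ℕ) = 2 * 2 from rfl, pow_mul, Real.sq_sqrt zero_le_two]; norm_num]
    simp
  rw [etaMul_fricke hz, mul_pow, mul_pow, div_pow, h2, I_pow_four, div_one]

lemma sqrt_two_pow_twelve : ((√2 : ℝ) : ℂ) ^ 12 = 64 := by
  rw [← Complex.ofReal_pow, show (√2 : ℝ) ^ 12 = 64 by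
    rw [show (12 : ℕ) = 2 * 6 from rfl, pow_mul, Real.sq_sqrt zero_le_two]; norm_num]
  simp

lemma nome_add_one (z : ℂ) : nome (z + 1) = nome z := by
  simpa using nome_add_int z 1

lemma etaMul_pow_four (z : ℂ) :
    etaMul z ^ 4 = cexp (2 * π * I * z * (1 / 2)) * eulerMul (nome z) ^ 4 := by
  rw [etaMul_eq, mul_pow, ← Complex.exp_nat_mul]
  congr 2; push_cast; ring

lemma weber_pow_twelve (z : ℂ) :
    weber z ^ 12 = cexp (-(2 * π * I * z * (1 / 2))) * eulerOdd (nome z) ^ 12 := by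
  rw [weber_eq, mul_pow, ← Complex.exp_nat_mul]
  congr 2; push_cast; ring

lemma eulerOdd_zero : eulerOdd 0 = 1 := by simp [eulerOdd, euler]

lemma eulerMul_zero : eulerMul 0 = 1 := by simp [eulerMul, euler]

lemma dlogWeber_zero : dlogWeber 0 = 1 := by simp [dlogWeber]

lemma dlogEtaMul_zero : dlogEtaMul 0 = 3 := by simp [dlogEtaMul]

lemma zero_mem_unit_ball : (0 : ℂ) ∈ Metric.ball (0 : ℂ) 1 := by simp

lemma differentiableAt_of_ball {f : ℂ → ℂ} (hf : DifferentiableOn ℂ f (Metric.ball 0 1))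
    {q : ℂ} (hq : q ∈ Metric.ball (0 : ℂ) 1) : DifferentiableAt ℂ f q :=
  hf.differentiableAt (Metric.isOpen_ball.mem_nhds hq)

lemma dlogWeber_sq_div {z : ℂ} (hz : 0 < z.im) :
    dlogWeber (nome z) ^ 2 / etaMul z ^ 4 - weber z ^ 12 - 64 / weber z ^ 12 = 0 := by
  set G : ℂ → ℂ :=
    fun z => dlogWeber (nome z) ^ 2 / etaMul z ^ 4 - weber z ^ 12 - 64 / weber z ^ 12 with hG
  have hT : ∀ z, 0 < z.im → ‖G (z + 1)‖ = ‖G z‖ := by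
    intro z hz
    rw [← norm_neg (G z)]
    simp only [hG, nome_add_one, weber_add_one_pow_twelve, etaMul_add_one_pow_four, div_neg]
    congr 1; ring
  have hW : ∀ z, 0 < z.im → ‖G (-1 / (2 * z))‖ = ‖G z‖ := by
    intro z hz
    have h0 := ne_zero_of_im_pos hz
    have h1 := weber_ne_zero hz
    have h2 := etaMul_ne_zero hz
    simp only [hG, dlogWeber_fricke hz, weber_fricke hz, etaMul_fricke_pow_four hz, div_pow,
      sqrt_two_pow_twelve]
    congr 1; field_simp; ring
  refine eq_zero_of_reduction (G := G) ?_ hT ?_ (by norm_num : (0 : ℝ) < 2 / 5)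
    (exists_reduction_of_fricke hT hW) hz
  · intro z hz
    have d1 := (hasDerivAt_comp_nome differentiableOn_dlogWeber hz).differentiableAt
    have d2 := differentiableAt_weber hz
    have d3 := differentiableAt_etaMul hz
    exact (((d1.pow 2).div (d3.pow 4) (pow_ne_zero _ (etaMul_ne_zero hz))).sub (d2.pow 12)).sub
      ((differentiableAt_const _).div (d2.pow 12) (pow_ne_zero _ (weber_ne_zero hz)))
  · set F : ℂ → ℂ := fun q =>
      dlogWeber q ^ 2 / eulerMul q ^ 4 - eulerOdd q ^ 12 - 64 * q / eulerOdd q ^ 12 with hF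
    have d1 := differentiableAt_of_ball differentiableOn_dlogWeber zero_mem_unit_ball
    have d2 := differentiableAt_of_ball differentiableOn_eulerOdd zero_mem_unit_ball
    have d3 := differentiableAt_of_ball differentiableOn_eulerMul zero_mem_unit_ball
    have hd : DifferentiableAt ℂ F 0 :=
      (((d1.pow 2).div (d3.pow 4) (pow_ne_zero _ (eulerMul_ne_zero zero_mem_unit_ball))).sub
        (d2.pow 12)).sub
      ((differentiableAt_id.const_mul 64).div (d2.pow 12)
        (pow_ne_zero _ (eulerOdd_ne_zero zero_mem_unit_ball)))
    have := tendsto_exp_mul_comp_nome (isBigO_of_differentiableAt hd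
      (by simp [hF, eulerOdd_zero, eulerMul_zero, dlogWeber_zero]))
    refine this.congr fun z => ?_
    simp only [hF, hG, etaMul_pow_four, weber_pow_twelve, Complex.exp_neg, CharP.cast_eq_zero,
      zero_add]
    have h2 : nome z = cexp (2 * π * I * z * (1 / 2)) ^ 2 := by
      rw [nome, ← Complex.exp_nat_mul]; congr 1; push_cast; ring
    have h3 := Complex.exp_ne_zero (2 * π * I * z * (1 / 2))
    generalize cexp (2 * π * I * z * (1 / 2)) = e at *
    generalize eulerMul (nome z) = a at *
    generalize eulerOdd (nome z) = b at *
    rw [h2]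
    field_simp

lemma dlogEtaMul_deriv_div {z : ℂ} (hz : 0 < z.im) :
    (24 * (nome z * deriv dlogEtaMul (nome z)) - dlogEtaMul (nome z) ^ 2 +
      9 * dlogWeber (nome z) ^ 2) / etaMul z ^ 4 = 0 := by
  set F : ℂ → ℂ :=
    fun q => 24 * (q * deriv dlogEtaMul q) - dlogEtaMul q ^ 2 + 9 * dlogWeber q ^ 2 with hF
  have hFd : DifferentiableOn ℂ F (Metric.ball 0 1) :=
    (((differentiableOn_id.mul (differentiableOn_dlogEtaMul.deriv Metric.isOpen_ball)).const_mul
      24).sub (differentiableOn_dlogEtaMul.pow 2)).add ((differentiableOn_dlogWeber.pow 2).const_mul 9)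
  set G : ℂ → ℂ := fun z => F (nome z) / etaMul z ^ 4 with hG
  have hT : ∀ z, 0 < z.im → ‖G (z + 1)‖ = ‖G z‖ := by
    intro z hz
    rw [← norm_neg (G z)]
    simp only [hG, nome_add_one, etaMul_add_one_pow_four, div_neg]
  have hW : ∀ z, 0 < z.im → ‖G (-1 / (2 * z))‖ = ‖G z‖ := by
    intro z hz
    have h0 := ne_zero_of_im_pos hz
    have h2 := etaMul_ne_zero hz
    have hpi : (π : ℂ) ≠ 0 := by simp [Real.pi_ne_zero]
    simp only [hG, hF, dlogWeber_fricke hz, dlogEtaMul_fricke hz, nome_deriv_dlogEtaMul_fricke hz,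
      etaMul_fricke_pow_four hz]
    congr 1; field_simp; ring
  refine eq_zero_of_reduction (G := G) ?_ hT ?_ (by norm_num : (0 : ℝ) < 2 / 5)
    (exists_reduction_of_fricke hT hW) hz
  · intro z hz
    exact (hasDerivAt_comp_nome hFd hz).differentiableAt.div ((differentiableAt_etaMul hz).pow 4)
      (pow_ne_zero _ (etaMul_ne_zero hz))
  · have hd : DifferentiableAt ℂ (fun q => F q / eulerMul q ^ 4) 0 :=
      (differentiableAt_of_ball hFd zero_mem_unit_ball).div
        ((differentiableAt_of_ball differentiableOn_eulerMul zero_mem_unit_ball).pow 4)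
        (pow_ne_zero _ (eulerMul_ne_zero zero_mem_unit_ball))
    have := tendsto_exp_mul_comp_nome (isBigO_of_differentiableAt hd
      (by simp [hF, dlogEtaMul_zero, dlogWeber_zero]; norm_num))
    refine this.congr fun z => ?_
    simp only [hG, etaMul_pow_four, Complex.exp_neg, CharP.cast_eq_zero, zero_add]
    have h3 := Complex.exp_ne_zero (2 * π * I * z * (1 / 2))
    field_simp

lemma exists_nome_eq {q : ℂ} (hq : q ∈ Metric.ball (0 : ℂ) 1) (h0 : q ≠ 0) :
    ∃ z : ℂ, 0 < z.im ∧ nome z = q := by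
  have hz : nome (Complex.log q / (2 * π * I)) = q := by
    rw [nome, mul_div_cancel₀ _ two_pi_I_ne_zero, Complex.exp_log h0]
  refine ⟨_, ?_, hz⟩
  rw [← hz, mem_ball_zero_iff, norm_nome, Real.exp_lt_one_iff] at hq
  have := Real.pi_pos
  nlinarith

/-- The square of the weight two form in terms of Euler products. -/
lemma dlogWeber_sq {q : ℂ} (hq : q ∈ Metric.ball (0 : ℂ) 1) :
    dlogWeber q ^ 2 * eulerOdd q ^ 12 = eulerMul q ^ 4 * (eulerOdd q ^ 24 + 64 * q) := by
  rcases eq_or_ne q 0 with rfl | h0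
  · simp [dlogWeber_zero, eulerOdd_zero, eulerMul_zero]
  obtain ⟨z, hz, rfl⟩ := exists_nome_eq hq h0
  have h := dlogWeber_sq_div hz
  have h1 := eulerOdd_ne_zero hq
  have h4 := eulerMul_ne_zero hq
  simp only [etaMul_pow_four, weber_pow_twelve, Complex.exp_neg] at h
  have h2 : nome z = cexp (2 * π * I * z * (1 / 2)) ^ 2 := by
    rw [nome, ← Complex.exp_nat_mul]; congr 1; push_cast; ring
  have h3 := Complex.exp_ne_zero (2 * π * I * z * (1 / 2))
  generalize cexp (2 * π * I * z * (1 / 2)) = e at *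
  generalize eulerMul (nome z) = a at *
  generalize eulerOdd (nome z) = b at *
  generalize dlogWeber (nome z) = c at *
  rw [h2]
  field_simp at h
  linear_combination h

lemma deriv_dlogEtaMul {q : ℂ} (hq : q ∈ Metric.ball (0 : ℂ) 1) :
    24 * (q * deriv dlogEtaMul q) = dlogEtaMul q ^ 2 - 9 * dlogWeber q ^ 2 := by
  rcases eq_or_ne q 0 with rfl | h0
  · simp [dlogWeber_zero, dlogEtaMul_zero]; norm_num
  obtain ⟨z, hz, rfl⟩ := exists_nome_eq hq h0
  have h := (div_eq_zero_iff.1 (dlogEtaMul_deriv_div hz)).resolve_right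
    (pow_ne_zero _ (etaMul_ne_zero hz))
  linear_combination h

lemma multipliable_one_sub_pow_add {q : ℂ} (hq : ‖q‖ < 1) (k : ℕ) :
    Multipliable fun n : ℕ => 1 - q ^ (n + k) := by
  simp_rw [sub_eq_add_neg]
  refine multipliable_one_add_of_summable ?_
  simp_rw [norm_neg, norm_pow, pow_add]
  exact (summable_geometric_of_lt_one (norm_nonneg q) hq).mul_right _

lemma norm_tprod_sub_one_le {q : ℂ} (hq : ‖q‖ < 1) (k : ℕ) :
    ‖∏' n : ℕ, (1 - q ^ (n + k)) - 1‖ ≤ Real.exp (‖q‖ ^ k / (1 - ‖q‖)) - 1 := by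
  have h := ((multipliable_one_sub_pow_add hq k).hasProd.tendsto_prod_nat.sub_const 1).norm
  refine le_of_tendsto h (Eventually.of_forall fun N => ?_)
  have h1 := (Finset.range N).norm_prod_one_add_sub_one_le (fun n => -q ^ (n + k))
  simp_rw [← sub_eq_add_neg] at h1
  refine h1.trans ?_
  gcongr
  simp_rw [norm_neg, norm_pow, pow_add, ← Finset.sum_mul]
  rw [mul_comm, div_eq_mul_inv, ← tsum_geometric_of_lt_one (norm_nonneg q) hq]
  gcongr
  exact (summable_geometric_of_lt_one (norm_nonneg q) hq).sum_le_tsum _ fun _ _ => by positivity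

lemma exp_sub_one_le {s : ℝ} (hs : s < 1) : Real.exp s - 1 ≤ s / (1 - s) := by
  have h := Real.add_one_le_exp (-s)
  have h1 : 0 < 1 - s := by linarith
  have h2 : Real.exp s * Real.exp (-s) = 1 := by rw [← Real.exp_add]; simp
  rw [le_div_iff₀ h1]
  nlinarith [Real.exp_pos s]

lemma norm_euler_sub_one_le {q : ℂ} (hq : ‖q‖ < 1 / 2) :
    ‖euler q - 1‖ ≤ ‖q‖ / (1 - 2 * ‖q‖) := by
  have h0 := norm_nonneg q
  have h2 : 0 < 1 - ‖q‖ := by linarith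
  refine (norm_tprod_sub_one_le (by linarith) 1).trans ?_
  rw [pow_one]
  refine (exp_sub_one_le (by rw [div_lt_one h2]; linarith)).trans (le_of_eq ?_)
  have h3 : 1 - 2 * ‖q‖ ≠ 0 := by linarith
  have h4 : 1 - ‖q‖ / (1 - ‖q‖) = (1 - 2 * ‖q‖) / (1 - ‖q‖) := by field_simp; ring
  rw [h4]; field_simp

lemma norm_eulerOdd_sub_one_le {q : ℂ} (hq : ‖q‖ ≤ 1 / 1000) : ‖eulerOdd q - 1‖ ≤ 1 / 900 := by
  have h0 := norm_nonneg q
  have hq2 : ‖q ^ 2‖ ≤ 1 / 1000000 := by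
    rw [norm_pow]; nlinarith
  have h1 : ‖euler q - 1‖ ≤ 1 / 998 := by
    refine (norm_euler_sub_one_le (by linarith)).trans ?_
    rw [div_le_iff₀ (by linarith)]; linarith
  have h2 : ‖euler (q ^ 2) - 1‖ ≤ 1 / 100000 := by
    refine (norm_euler_sub_one_le (by linarith)).trans ?_
    rw [div_le_iff₀ (by linarith)]; linarith
  have hne : euler (q ^ 2) ≠ 0 := euler_ne_zero (by linarith)
  have h3 : 1 - 1 / 100000 ≤ ‖euler (q ^ 2)‖ := by
    have := norm_sub_norm_le (1 : ℂ) (euler (q ^ 2))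
    rw [norm_sub_rev, norm_one] at this
    linarith
  rw [show eulerOdd q - 1 = ((euler q - 1) - (euler (q ^ 2) - 1)) / euler (q ^ 2) by
    rw [eulerOdd]; field_simp; ring, norm_div, div_le_iff₀ (by linarith)]
  have := norm_sub_le (euler q - 1) (euler (q ^ 2) - 1)
  linarith

lemma norm_eulerOdd_bounds {q : ℂ} (hq : ‖q‖ ≤ 1 / 1000) :
    899 / 900 ≤ ‖eulerOdd q‖ ∧ ‖eulerOdd q‖ ≤ 901 / 900 := by
  have h := norm_eulerOdd_sub_one_le hq
  have h1 := norm_sub_norm_le (1 : ℂ) (eulerOdd q)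
  have h2 := norm_sub_norm_le (eulerOdd q) 1
  rw [norm_sub_rev, norm_one] at h1
  rw [norm_one] at h2
  constructor <;> linarith

/-- The coefficients `(4n)! / (n!)^4`. -/
noncomputable def coef (n : ℕ) : ℂ := ((4 * n).factorial : ℂ) / (n.factorial : ℂ) ^ 4

/-- The series `∑ n ^ k (4n)! / (n!)^4 x ^ n`. -/
noncomputable def hyper (k : ℕ) (x : ℂ) : ℂ := ∑' n : ℕ, (n : ℂ) ^ k * coef n * x ^ n

lemma coef_succ (n : ℕ) :
    ((n : ℂ) + 1) ^ 3 * coef (n + 1) = 8 * (4 * n + 1) * (2 * n + 1) * (4 * n + 3) * coef n := by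
  have h1 : (n.factorial : ℂ) ≠ 0 := by exact_mod_cast n.factorial_ne_zero
  have h2 : (n : ℂ) + 1 ≠ 0 := by exact_mod_cast n.succ_ne_zero
  rw [coef, coef, show 4 * (n + 1) = 4 * n + 1 + 1 + 1 + 1 by ring]
  simp only [Nat.factorial_succ]
  push_cast
  field_simp
  ring

lemma norm_coef_le (n : ℕ) : ‖coef n‖ ≤ 256 ^ n := by
  induction n with
  | zero => simp [coef]
  | succ n ih =>
    have h := congrArg norm (coef_succ n)
    have e1 : ‖((n : ℂ) + 1) ^ 3 * coef (n + 1)‖ = ((n : ℝ) + 1) ^ 3 * ‖coef (n + 1)‖ := by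
      rw [norm_mul, norm_pow, show (n : ℂ) + 1 = ((n + 1 : ℕ) : ℂ) by push_cast; ring,
        Complex.norm_natCast]; push_cast; ring
    have e2 : ‖8 * (4 * n + 1) * (2 * n + 1) * (4 * n + 3) * coef n‖
        = 8 * (4 * n + 1) * (2 * n + 1) * (4 * n + 3) * ‖coef n‖ := by
      rw [norm_mul, show (8 : ℂ) * (4 * n + 1) * (2 * n + 1) * (4 * n + 3)
        = ((8 * (4 * n + 1) * (2 * n + 1) * (4 * n + 3) : ℕ) : ℂ) by push_cast; ring,
        Complex.norm_natCast]; push_cast; ring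
    rw [e1, e2] at h
    have hp : (0 : ℝ) < ((n : ℝ) + 1) ^ 3 := by positivity
    refine le_of_mul_le_mul_left ?_ hp
    rw [h]
    calc _ ≤ (256 * ((n : ℝ) + 1) ^ 3) * ‖coef n‖ := by
          have : (0 : ℝ) ≤ n := n.cast_nonneg
          refine mul_le_mul_of_nonneg_right ?_ (norm_nonneg _)
          nlinarith [mul_nonneg this this]
      _ ≤ (256 * ((n : ℝ) + 1) ^ 3) * 256 ^ n := by gcongr
      _ = _ := by ring

lemma norm_hyper_term_le (k n : ℕ) (x : ℂ) :
    ‖(n : ℂ) ^ k * coef n * x ^ n‖ ≤ (n : ℝ) ^ k * (256 * ‖x‖) ^ n := by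
  rw [norm_mul, norm_mul, norm_pow, norm_pow, Complex.norm_natCast, mul_pow, mul_assoc]
  gcongr
  exact norm_coef_le n

lemma summable_hyper (k : ℕ) {x : ℂ} (hx : ‖x‖ < 1 / 256) :
    Summable fun n : ℕ => (n : ℂ) ^ k * coef n * x ^ n := by
  refine Summable.of_norm_bounded (summable_pow_mul_geometric_of_norm_lt_one k ?_)
    (norm_hyper_term_le k · x)
  rw [Real.norm_of_nonneg (by positivity)]; linarith

lemma hasDerivAt_hyper (k : ℕ) {x : ℂ} (hx : ‖x‖ < 1 / 256) :
    HasDerivAt (hyper k) (∑' n : ℕ, (n : ℂ) ^ k * coef n * (n * x ^ (n - 1))) x := by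
  obtain ⟨ρ, h1, h2⟩ := exists_between hx
  have hρ : 0 < ρ := (norm_nonneg x).trans_lt h1
  have hu : Summable fun n : ℕ => (n : ℝ) ^ (k + 1) * (256 * ρ) ^ n * ρ⁻¹ := by
    have h3 : ‖256 * ρ‖ < 1 := by rw [Real.norm_of_nonneg (by positivity)]; linarith
    exact (summable_pow_mul_geometric_of_norm_lt_one (k + 1) h3).mul_right ρ⁻¹
  refine hasDerivAt_tsum_of_isPreconnected hu Metric.isOpen_ball
    (convex_ball (0 : ℂ) ρ).isPreconnected
    (g := fun (n : ℕ) (y : ℂ) => (n : ℂ) ^ k * coef n * y ^ n)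
    (g' := fun (n : ℕ) (y : ℂ) => (n : ℂ) ^ k * coef n * (n * y ^ (n - 1))) (y₀ := 0)
    (fun n y _ => (hasDerivAt_pow n y).const_mul _) ?_ (Metric.mem_ball_self hρ)
    (summable_hyper k (by simp)) (mem_ball_zero_iff.2 h1)
  intro n y hy
  rcases n with _ | n
  · simp
  have hy' : ‖y‖ ≤ ρ := (mem_ball_zero_iff.1 hy).le
  rw [norm_mul, norm_mul, norm_mul, norm_pow, norm_pow, Complex.norm_natCast, Nat.add_sub_cancel]
  calc _ ≤ ((n + 1 : ℕ) : ℝ) ^ k * 256 ^ (n + 1) * ((n + 1 : ℕ) * ρ ^ n) := by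
        gcongr; exact norm_coef_le _
    _ = _ := by rw [mul_pow]; field_simp; ring

lemma differentiableAt_hyper (k : ℕ) {x : ℂ} (hx : ‖x‖ < 1 / 256) :
    DifferentiableAt ℂ (hyper k) x := (hasDerivAt_hyper k hx).differentiableAt

lemma mul_deriv_hyper (k : ℕ) {x : ℂ} (hx : ‖x‖ < 1 / 256) :
    x * deriv (hyper k) x = hyper (k + 1) x := by
  rw [(hasDerivAt_hyper k hx).deriv, ← tsum_mul_left]
  refine tsum_congr fun n => ?_
  rcases n with _ | n
  · simp
  · rw [Nat.add_sub_cancel]; ring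

lemma hyper_ode {x : ℂ} (hx : ‖x‖ < 1 / 256) :
    hyper 3 x = x * (256 * hyper 3 x + 384 * hyper 2 x + 176 * hyper 1 x + 24 * hyper 0 x) := by
  have s := fun k => summable_hyper k hx
  have hR : 256 * hyper 3 x + 384 * hyper 2 x + 176 * hyper 1 x + 24 * hyper 0 x =
      ∑' n : ℕ, (256 * ((n : ℂ) ^ 3 * coef n * x ^ n) + 384 * ((n : ℂ) ^ 2 * coef n * x ^ n) +
        176 * ((n : ℂ) ^ 1 * coef n * x ^ n) + 24 * ((n : ℂ) ^ 0 * coef n * x ^ n)) := by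
    exact (((((s 3).hasSum.mul_left 256).add ((s 2).hasSum.mul_left 384)).add
      ((s 1).hasSum.mul_left 176)).add ((s 0).hasSum.mul_left 24)).tsum_eq.symm
  rw [hR, hyper, (s 3).tsum_eq_zero_add, ← tsum_mul_left]
  simp only [Nat.cast_zero, ne_eq, OfNat.ofNat_ne_zero, not_false_eq_true, zero_pow, zero_mul,
    zero_add]
  refine tsum_congr fun n => ?_
  have := coef_succ n
  push_cast
  linear_combination x ^ (n + 1) * this

/-- Uniqueness for the hypergeometric equation, for solutions analytic at the origin in a
coordinate `q`, where `θ = κ q d/dq`. -/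
lemma eventually_eq_zero_of_ode {κ x f₀ f₁ f₂ f₃ : ℂ → ℂ} (hκ : AnalyticAt ℂ κ 0)
    (hκ0 : κ 0 = 1) (hx : ContinuousAt x 0) (hx0 : x 0 = 0) (hf : AnalyticAt ℂ f₀ 0)
    (hf0 : f₀ 0 = 0)
    (h1 : ∀ᶠ q in 𝓝 0, f₁ q = κ q * (q * deriv f₀ q))
    (h2 : ∀ᶠ q in 𝓝 0, f₂ q = κ q * (q * deriv f₁ q))
    (h3 : ∀ᶠ q in 𝓝 0, f₃ q = κ q * (q * deriv f₂ q))
    (hode : ∀ᶠ q in 𝓝 0, f₃ q = x q * (256 * f₃ q + 384 * f₂ q + 176 * f₁ q + 24 * f₀ q)) :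
    ∀ᶠ q in 𝓝 0, f₀ q = 0 := by
  by_contra hne
  obtain ⟨m, g₀, hg, hg0, hfg⟩ := hf.exists_eventuallyEq_pow_smul_nonzero_iff.2 hne
  simp only [sub_zero, smul_eq_mul] at hfg
  have hm : m ≠ 0 := by
    rintro rfl
    have := hfg.self_of_nhds
    rw [hf0] at this
    simp at this
    exact hg0 this.symm
  have step : ∀ f f' g : ℂ → ℂ, AnalyticAt ℂ g 0 → (∀ᶠ q in 𝓝 0, f q = q ^ m * g q) →
      (∀ᶠ q in 𝓝 0, f' q = κ q * (q * deriv f q)) →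
      ∃ g', AnalyticAt ℂ g' 0 ∧ g' 0 = m * g 0 ∧ ∀ᶠ q in 𝓝 0, f' q = q ^ m * g' q := by
    intro f f' g hg hf hf'
    refine ⟨fun q => κ q * (m * g q + q * deriv g q),
      hκ.mul ((analyticAt_const.mul hg).add (analyticAt_id.mul hg.deriv)), by simp [hκ0], ?_⟩
    filter_upwards [hf', hf.eventually_nhds, hg.eventually_analyticAt] with q h h' h''
    have hd : deriv f q = m * q ^ (m - 1) * g q + q ^ m * deriv g q :=
      (((hasDerivAt_pow m q).mul h''.differentiableAt.hasDerivAt).congr_of_eventuallyEq h').deriv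
    rw [h, hd]
    obtain ⟨j, rfl⟩ := Nat.exists_eq_succ_of_ne_zero hm
    simp only [Nat.succ_eq_add_one, Nat.add_sub_cancel]
    ring
  obtain ⟨g₁, hg1, e1, hfg1⟩ := step _ _ _ hg hfg h1
  obtain ⟨g₂, hg2, e2, hfg2⟩ := step _ _ _ hg1 hfg1 h2
  obtain ⟨g₃, hg3, e3, hfg3⟩ := step _ _ _ hg2 hfg2 h3
  set r : ℂ → ℂ := fun q => g₃ q - x q * (256 * g₃ q + 384 * g₂ q + 176 * g₁ q + 24 * g₀ q) with hr
  have hrc : ContinuousAt r 0 := by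
    have c0 := hg.continuousAt
    have c1 := hg1.continuousAt
    have c2 := hg2.continuousAt
    have c3 := hg3.continuousAt
    fun_prop
  have hr0 : ∀ᶠ q in 𝓝[≠] 0, r q = 0 := by
    filter_upwards [self_mem_nhdsWithin, hode.filter_mono nhdsWithin_le_nhds,
      hfg.filter_mono nhdsWithin_le_nhds, hfg1.filter_mono nhdsWithin_le_nhds,
      hfg2.filter_mono nhdsWithin_le_nhds, hfg3.filter_mono nhdsWithin_le_nhds]
      with q hq h a0 a1 a2 a3
    rw [a0, a1, a2, a3] at h
    refine mul_left_cancel₀ (pow_ne_zero m hq) ?_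
    simp only [hr]
    linear_combination h
  have := tendsto_nhds_unique ((hrc.tendsto.mono_left nhdsWithin_le_nhds).congr' hr0)
    tendsto_const_nhds
  simp only [hr, hx0, zero_mul, sub_zero, e3, e2, e1] at this
  simp [hm, hg0] at this

/-- `f' = q f'(q)`: the derivative of `f` along the Euler vector field `q d/dq`. -/
def HasEulerDeriv (f : ℂ → ℂ) (f' q : ℂ) : Prop := ∃ d, HasDerivAt f d q ∧ q * d = f'

namespace HasEulerDeriv

variable {f g : ℂ → ℂ} {f' g' q : ℂ}

lemma const (c q : ℂ) : HasEulerDeriv (fun _ => c) 0 q := ⟨0, hasDerivAt_const _ _, mul_zero _⟩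

lemma id (q : ℂ) : HasEulerDeriv (fun q => q) q q := ⟨1, hasDerivAt_id' q, mul_one _⟩

lemma add (hf : HasEulerDeriv f f' q) (hg : HasEulerDeriv g g' q) :
    HasEulerDeriv (fun q => f q + g q) (f' + g') q := by
  obtain ⟨d, hd, rfl⟩ := hf
  obtain ⟨e, he, rfl⟩ := hg
  exact ⟨d + e, hd.add he, by ring⟩

lemma sub (hf : HasEulerDeriv f f' q) (hg : HasEulerDeriv g g' q) :
    HasEulerDeriv (fun q => f q - g q) (f' - g') q := by
  obtain ⟨d, hd, rfl⟩ := hf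
  obtain ⟨e, he, rfl⟩ := hg
  exact ⟨d - e, hd.sub he, by ring⟩

lemma mul (hf : HasEulerDeriv f f' q) (hg : HasEulerDeriv g g' q) :
    HasEulerDeriv (fun q => f q * g q) (f' * g q + f q * g') q := by
  obtain ⟨d, hd, rfl⟩ := hf
  obtain ⟨e, he, rfl⟩ := hg
  exact ⟨_, hd.mul he, by ring⟩

lemma div (hf : HasEulerDeriv f f' q) (hg : HasEulerDeriv g g' q) (h0 : g q ≠ 0) :
    HasEulerDeriv (fun q => f q / g q) ((f' * g q - f q * g') / g q ^ 2) q := by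
  obtain ⟨d, hd, rfl⟩ := hf
  obtain ⟨e, he, rfl⟩ := hg
  exact ⟨_, hd.fun_div he h0, by ring⟩

lemma pow (hf : HasEulerDeriv f f' q) (n : ℕ) :
    HasEulerDeriv (fun q => f q ^ n) (n * f q ^ (n - 1) * f') q := by
  obtain ⟨d, hd, rfl⟩ := hf
  exact ⟨_, hd.fun_pow n, by ring⟩

lemma const_mul (c : ℂ) (hf : HasEulerDeriv f f' q) :
    HasEulerDeriv (fun q => c * f q) (c * f') q := by
  obtain ⟨d, hd, rfl⟩ := hf
  exact ⟨_, hd.const_mul c, by ring⟩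

lemma congr_deriv (hf : HasEulerDeriv f f' q) (h : f' = g') : HasEulerDeriv f g' q := h ▸ hf

lemma mul_deriv (hf : HasEulerDeriv f f' q) : q * deriv f q = f' := by
  obtain ⟨d, hd, rfl⟩ := hf
  rw [hd.deriv]

lemma congr_fun (hf : HasEulerDeriv f f' q) (h : ∀ᶠ x in 𝓝 q, g x = f x) :
    HasEulerDeriv g f' q := by
  obtain ⟨d, hd, rfl⟩ := hf
  exact ⟨d, hd.congr_of_eventuallyEq h, rfl⟩

lemma unique (hf : HasEulerDeriv f f' q) (hg : HasEulerDeriv f g' q) : f' = g' := by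
  rw [← hf.mul_deriv, hg.mul_deriv]

lemma of_differentiableOn_ball (hf : DifferentiableOn ℂ f (Metric.ball 0 1))
    (hq : q ∈ Metric.ball (0 : ℂ) 1) : HasEulerDeriv f (q * deriv f q) q :=
  ⟨_, hasDerivAt_of_differentiableOn_ball hf hq, rfl⟩

end HasEulerDeriv

/-- The common denominator `p ^ 24 + 64 q` of the level two moduli. -/
noncomputable def modDen (q : ℂ) : ℂ := eulerOdd q ^ 24 + 64 * q

/-- The multiplier `(U - 64) / (U + 64)` with `U = (η(z) / η(2z)) ^ 24`. -/
noncomputable def modR (q : ℂ) : ℂ := (eulerOdd q ^ 24 - 64 * q) / modDen q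

/-- The Hauptmodul `U / (U + 64) ^ 2` with `U = (η(z) / η(2z)) ^ 24`. -/
noncomputable def modX (q : ℂ) : ℂ := q * eulerOdd q ^ 24 / modDen q ^ 2

lemma mem_unit_ball_of_small {q : ℂ} (hq : q ∈ Metric.ball (0 : ℂ) (1 / 1000)) :
    q ∈ Metric.ball (0 : ℂ) 1 := Metric.ball_subset_ball (by norm_num) hq

lemma norm_eulerOdd_pow_bounds {q : ℂ} (hq : q ∈ Metric.ball (0 : ℂ) (1 / 1000)) :
    97 / 100 ≤ ‖eulerOdd q ^ 24‖ ∧ ‖eulerOdd q ^ 24‖ ≤ 11 / 10 := by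
  obtain ⟨h1, h2⟩ := norm_eulerOdd_bounds (mem_ball_zero_iff.1 hq).le
  rw [norm_pow]
  exact ⟨(by norm_num : (97 / 100 : ℝ) ≤ (899 / 900) ^ 24).trans (by gcongr),
    (show ‖eulerOdd q‖ ^ 24 ≤ (901 / 900) ^ 24 by gcongr).trans (by norm_num)⟩

lemma norm_modDen_ge {q : ℂ} (hq : q ∈ Metric.ball (0 : ℂ) (1 / 1000)) :
    9 / 10 ≤ ‖modDen q‖ := by
  have h1 := (norm_eulerOdd_pow_bounds hq).1
  have h2 := norm_sub_le_norm_add (eulerOdd q ^ 24) (64 * q)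
  have h3 := mem_ball_zero_iff.1 hq
  rw [norm_mul, RCLike.norm_ofNat] at h2
  rw [modDen]
  linarith

lemma modDen_ne_zero {q : ℂ} (hq : q ∈ Metric.ball (0 : ℂ) (1 / 1000)) : modDen q ≠ 0 :=
  norm_pos_iff.1 ((by norm_num : (0 : ℝ) < 9 / 10).trans_le (norm_modDen_ge hq))

lemma norm_modX_lt {q : ℂ} (hq : q ∈ Metric.ball (0 : ℂ) (1 / 1000)) : ‖modX q‖ < 1 / 256 := by
  have h1 := (norm_eulerOdd_pow_bounds hq).2
  have h2 := norm_modDen_ge hq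
  have h3 := mem_ball_zero_iff.1 hq
  rw [modX, norm_div, norm_mul, norm_pow (modDen q), div_lt_iff₀ (by positivity)]
  calc _ ≤ 1 / 1000 * (11 / 10 : ℝ) := by gcongr
    _ < 1 / 256 * (9 / 10) ^ 2 := by norm_num
    _ ≤ _ := by gcongr

lemma differentiableOn_modDen : DifferentiableOn ℂ modDen (Metric.ball 0 1) :=
  (differentiableOn_eulerOdd.pow 24).add (differentiableOn_id.const_mul 64)

lemma differentiableOn_modR : DifferentiableOn ℂ modR (Metric.ball 0 (1 / 1000)) :=
  (((differentiableOn_eulerOdd.pow 24).sub (differentiableOn_id.const_mul 64)).mono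
    fun _ => mem_unit_ball_of_small).div
    (differentiableOn_modDen.mono fun _ => mem_unit_ball_of_small) fun _ => modDen_ne_zero

lemma differentiableOn_modX : DifferentiableOn ℂ modX (Metric.ball 0 (1 / 1000)) :=
  ((differentiableOn_id.mul (differentiableOn_eulerOdd.pow 24)).mono
    fun _ => mem_unit_ball_of_small).div
    ((differentiableOn_modDen.mono fun _ => mem_unit_ball_of_small).pow 2)
    fun _ h => pow_ne_zero 2 (modDen_ne_zero h)

lemma hasEulerDeriv_eulerOdd {q : ℂ} (hq : q ∈ Metric.ball (0 : ℂ) 1) :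
    HasEulerDeriv eulerOdd (eulerOdd q * (1 - dlogWeber q) / 24) q := by
  refine (HasEulerDeriv.of_differentiableOn_ball differentiableOn_eulerOdd hq).congr_deriv ?_
  have := eulerOdd_ne_zero hq
  rw [dlogWeber]; field_simp; ring

lemma hasEulerDeriv_eulerMul {q : ℂ} (hq : q ∈ Metric.ball (0 : ℂ) 1) :
    HasEulerDeriv eulerMul (eulerMul q * (dlogEtaMul q - 3) / 24) q := by
  refine (HasEulerDeriv.of_differentiableOn_ball differentiableOn_eulerMul hq).congr_deriv ?_
  have := eulerMul_ne_zero hq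
  rw [dlogEtaMul]; field_simp; ring

lemma hasEulerDeriv_dlogEtaMul {q : ℂ} (hq : q ∈ Metric.ball (0 : ℂ) 1) :
    HasEulerDeriv dlogEtaMul ((dlogEtaMul q ^ 2 - 9 * dlogWeber q ^ 2) / 24) q := by
  refine (HasEulerDeriv.of_differentiableOn_ball differentiableOn_dlogEtaMul hq).congr_deriv ?_
  linear_combination deriv_dlogEtaMul hq / 24

lemma hasEulerDeriv_eulerOdd_pow {q : ℂ} (hq : q ∈ Metric.ball (0 : ℂ) 1) :
    HasEulerDeriv (fun q => eulerOdd q ^ 24) (eulerOdd q ^ 24 * (1 - dlogWeber q)) q :=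
  ((hasEulerDeriv_eulerOdd hq).pow 24).congr_deriv (by push_cast; ring)

lemma hasEulerDeriv_modDen {q : ℂ} (hq : q ∈ Metric.ball (0 : ℂ) 1) :
    HasEulerDeriv modDen (eulerOdd q ^ 24 * (1 - dlogWeber q) + 64 * q) q :=
  (hasEulerDeriv_eulerOdd_pow hq).add ((HasEulerDeriv.id q).const_mul 64)

lemma hasEulerDeriv_modX {q : ℂ} (hq : q ∈ Metric.ball (0 : ℂ) (1 / 1000)) :
    HasEulerDeriv modX (modX q * dlogWeber q * modR q) q := by
  have hq1 := mem_unit_ball_of_small hq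
  have h0 := modDen_ne_zero hq
  refine (((HasEulerDeriv.id q).mul (hasEulerDeriv_eulerOdd_pow hq1)).div
    ((hasEulerDeriv_modDen hq1).pow 2) (pow_ne_zero 2 h0)).congr_deriv ?_
  simp only [modX, modR]
  push_cast
  have hd : eulerOdd q ^ 24 = modDen q - 64 * q := by rw [modDen]; ring
  generalize eulerOdd q ^ 24 = w at *
  subst hd
  field_simp
  ring

lemma hasEulerDeriv_modR {q : ℂ} (hq : q ∈ Metric.ball (0 : ℂ) (1 / 1000)) :
    HasEulerDeriv modR (-(dlogWeber q * (1 - modR q ^ 2) / 2)) q := by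
  have hq1 := mem_unit_ball_of_small hq
  have h0 := modDen_ne_zero hq
  refine (((hasEulerDeriv_eulerOdd_pow hq1).sub ((HasEulerDeriv.id q).const_mul 64)).div
    (hasEulerDeriv_modDen hq1) h0).congr_deriv ?_
  simp only [modR]
  have hd : eulerOdd q ^ 24 = modDen q - 64 * q := by rw [modDen]; ring
  generalize eulerOdd q ^ 24 = w at *
  subst hd
  field_simp
  ring

lemma modX_eq {q : ℂ} (hq : q ∈ Metric.ball (0 : ℂ) (1 / 1000)) :
    256 * modX q = 1 - modR q ^ 2 := by
  have h0 := modDen_ne_zero hq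
  rw [modX, modR]
  have hd : eulerOdd q ^ 24 = modDen q - 64 * q := by rw [modDen]; ring
  generalize eulerOdd q ^ 24 = w at *
  subst hd
  field_simp
  ring

lemma hasEulerDeriv_dlogWeber {q : ℂ} (hq : q ∈ Metric.ball (0 : ℂ) (1 / 1000))
    (hZ : dlogWeber q ≠ 0) :
    HasEulerDeriv dlogWeber (dlogWeber q * (dlogEtaMul q / 12 - dlogWeber q * modR q / 4)) q := by
  have hq1 := mem_unit_ball_of_small hq
  have hp := eulerOdd_ne_zero hq1
  have h0 := modDen_ne_zero hq
  have hd := HasEulerDeriv.of_differentiableOn_ball differentiableOn_dlogWeber hq1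
  refine hd.congr_deriv ?_
  generalize q * deriv dlogWeber q = d at *
  have h1 := (hd.pow 2).mul ((hasEulerDeriv_eulerOdd hq1).pow 12)
  have h2 := ((hasEulerDeriv_eulerMul hq1).pow 4).mul (hasEulerDeriv_modDen hq1)
  have h3 := h1.unique (h2.congr_fun
    (eventually_of_mem (Metric.isOpen_ball.mem_nhds hq1) fun _ => dlogWeber_sq))
  have h4 := dlogWeber_sq hq1
  have hr : modR q * modDen q = eulerOdd q ^ 24 - 64 * q := div_mul_cancel₀ _ h0
  have h5 : 2 * dlogWeber q * eulerOdd q ^ 12 * modDen q * (d - dlogWeber q *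
      (dlogEtaMul q / 12 - dlogWeber q * modR q / 4)) = 0 := by
    push_cast at h3
    rw [modDen] at *
    linear_combination (eulerOdd q ^ 24 + 64 * q) * h3 -
      ((dlogEtaMul q - 3) / 6 * (eulerOdd q ^ 24 + 64 * q) +
        (eulerOdd q ^ 24 * (1 - dlogWeber q) + 64 * q)) * h4 +
      dlogWeber q ^ 3 * eulerOdd q ^ 12 / 2 * hr
  have h6 := (mul_eq_zero.1 h5).resolve_left (by simp [hZ, hp, h0])
  linear_combination h6

lemma hasEulerDeriv_hyper (k : ℕ) {q : ℂ} (hq : q ∈ Metric.ball (0 : ℂ) (1 / 1000)) :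
    HasEulerDeriv (fun q => hyper k (modX q))
      (dlogWeber q * modR q * hyper (k + 1) (modX q)) q := by
  obtain ⟨d, hd, h⟩ := hasEulerDeriv_modX hq
  have hx := norm_modX_lt hq
  refine ⟨_, (differentiableAt_hyper k hx).hasDerivAt.comp q hd, ?_⟩
  rw [← mul_deriv_hyper k hx]
  linear_combination deriv (hyper k) (modX q) * h

lemma modR_zero : modR 0 = 1 := by simp [modR, modDen, eulerOdd_zero]

lemma modX_zero : modX 0 = 0 := by simp [modX]

lemma hyper_zero_zero : hyper 0 0 = 1 := by
  rw [hyper, tsum_eq_single 0 (by intro n hn; simp [hn])]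
  simp [coef]

lemma zero_mem_small_ball : (0 : ℂ) ∈ Metric.ball (0 : ℂ) (1 / 1000) := by simp

lemma analyticAt_zero_of_ball {f : ℂ → ℂ} (hf : DifferentiableOn ℂ f (Metric.ball 0 (1 / 1000))) :
    AnalyticAt ℂ f 0 :=
  hf.analyticAt (Metric.isOpen_ball.mem_nhds zero_mem_small_ball)

lemma differentiableOn_dlogWeber_sub_hyper :
    DifferentiableOn ℂ (fun q => dlogWeber q - hyper 0 (modX q)) (Metric.ball 0 (1 / 1000)) := by
  refine (differentiableOn_dlogWeber.mono fun _ => mem_unit_ball_of_small).sub fun q hq => ?_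
  obtain ⟨d, hd, -⟩ := hasEulerDeriv_hyper 0 hq
  exact hd.differentiableAt.differentiableWithinAt

lemma eventually_dlogWeber_sub_hyper : ∀ᶠ q in 𝓝 0, dlogWeber q - hyper 0 (modX q) = 0 := by
  have hZa : AnalyticAt ℂ dlogWeber 0 :=
    analyticAt_zero_of_ball (differentiableOn_dlogWeber.mono fun _ => mem_unit_ball_of_small)
  have hRa := analyticAt_zero_of_ball differentiableOn_modR
  have hZ : ∀ᶠ q in 𝓝 0, dlogWeber q ≠ 0 :=
    hZa.continuousAt.eventually_ne (by simp [dlogWeber_zero])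
  have hR : ∀ᶠ q in 𝓝 0, modR q ≠ 0 := hRa.continuousAt.eventually_ne (by simp [modR_zero])
  have hB : ∀ᶠ q in 𝓝 0, q ∈ Metric.ball (0 : ℂ) (1 / 1000) :=
    Metric.isOpen_ball.mem_nhds zero_mem_small_ball
  set f₁ : ℂ → ℂ := fun q => dlogEtaMul q / (12 * modR q) - dlogWeber q / 4 - hyper 1 (modX q)
    with hf₁
  set f₂ : ℂ → ℂ := fun q => (dlogEtaMul q ^ 2 - 9 * dlogWeber q ^ 2) /
      (288 * (dlogWeber q * modR q ^ 2)) + dlogEtaMul q * (1 - modR q ^ 2) / (24 * modR q ^ 3) -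
      dlogEtaMul q / (48 * modR q) + dlogWeber q / 16 - hyper 2 (modX q) with hf₂
  refine eventually_eq_zero_of_ode (κ := fun q => 1 / (dlogWeber q * modR q)) (x := modX)
    (f₁ := f₁) (f₂ := f₂) (f₃ := fun q => 1 / (dlogWeber q * modR q) * (q * deriv f₂ q))
    (analyticAt_const.div (hZa.mul hRa) (by simp [dlogWeber_zero, modR_zero]))
    (by simp [dlogWeber_zero, modR_zero])
    (analyticAt_zero_of_ball differentiableOn_modX).continuousAt modX_zero
    (analyticAt_zero_of_ball differentiableOn_dlogWeber_sub_hyper)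
    (by simp [dlogWeber_zero, modX_zero, hyper_zero_zero]) ?_ ?_
    (Eventually.of_forall fun _ => rfl) ?_
  · filter_upwards [hZ, hR, hB] with q hZ hR hB
    rw [((hasEulerDeriv_dlogWeber hB hZ).sub (hasEulerDeriv_hyper 0 hB)).mul_deriv]
    simp only [hf₁]
    field_simp
  · filter_upwards [hZ, hR, hB] with q hZ hR hB
    have h1 := (((hasEulerDeriv_dlogEtaMul (mem_unit_ball_of_small hB)).div
      ((hasEulerDeriv_modR hB).const_mul 12) (by simpa using hR)).sub
      ((hasEulerDeriv_dlogWeber hB hZ).div (HasEulerDeriv.const 4 q) (by norm_num))).sub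
      (hasEulerDeriv_hyper 1 hB)
    rw [h1.mul_deriv]
    simp only [hf₂]
    field_simp
    ring
  · filter_upwards [hZ, hR, hB] with q hZ hR hB
    have hC := hasEulerDeriv_dlogEtaMul (mem_unit_ball_of_small hB)
    have hW := hasEulerDeriv_dlogWeber hB hZ
    have hr := hasEulerDeriv_modR hB
    have h1 := ((((((hC.pow 2).sub ((hW.pow 2).const_mul 9)).div
      ((hW.mul (hr.pow 2)).const_mul 288) (by simp [hZ, hR])).add
      ((hC.mul ((HasEulerDeriv.const 1 q).sub (hr.pow 2))).div ((hr.pow 3).const_mul 24)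
        (by simp [hR]))).sub (hC.div (hr.const_mul 48) (by simpa using hR))).add
      (hW.div (HasEulerDeriv.const 16 q) (by norm_num))).sub (hasEulerDeriv_hyper 2 hB)
    rw [h1.mul_deriv]
    have h2 := hyper_ode (norm_modX_lt hB)
    have hx : modX q = (1 - modR q ^ 2) / 256 := by linear_combination modX_eq hB / 256
    simp only [hf₁, hf₂]
    generalize hyper 3 (modX q) = s3 at *
    generalize hyper 2 (modX q) = s2 at *
    generalize hyper 1 (modX q) = s1 at *
    generalize hyper 0 (modX q) = s0 at *
    rw [hx] at h2 ⊢
    push_cast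
    norm_num
    field_simp
    field_simp at h2
    linear_combination -(16 * 2 * 24 ^ 2 * 12 * 4 * 288 * 48 * modR q ^ 5 * dlogWeber q ^ 2) * h2

lemma dlogWeber_eq_hyper {q : ℂ} (hq : q ∈ Metric.ball (0 : ℂ) (1 / 1000)) :
    dlogWeber q = hyper 0 (modX q) := by
  have h := (differentiableOn_dlogWeber_sub_hyper.analyticOnNhd Metric.isOpen_ball)
  have h' := h.eqOn_zero_of_preconnected_of_eventuallyEq_zero
    (convex_ball _ _).isPreconnected zero_mem_small_ball eventually_dlogWeber_sub_hyper hq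
  exact sub_eq_zero.1 h'

/-- The root of unity `exp (2 π i n / 24)`. -/
noncomputable def zeta (n : ℤ) : ℂ := cexp (2 * π * I / 24 * n)

lemma zeta_add (m n : ℤ) : zeta (m + n) = zeta m * zeta n := by
  rw [zeta, zeta, zeta, ← Complex.exp_add]; push_cast; ring_nf

lemma zeta_zero : zeta 0 = 1 := by simp [zeta]

lemma zeta_congr {m n : ℤ} (h : (24 : ℤ) ∣ m - n) : zeta m = zeta n := by
  obtain ⟨k, hk⟩ := h
  obtain rfl : m = n + 24 * k := by linarith
  rw [zeta_add, show zeta (24 * k) = 1 from ?_, mul_one]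
  rw [zeta, ← Complex.exp_int_mul_two_pi_mul_I k]
  push_cast; ring_nf

lemma zeta_ne_zero (n : ℤ) : zeta n ≠ 0 := Complex.exp_ne_zero _

lemma weber_add_int_eq (z : ℂ) (n : ℤ) : weber (z + n) = zeta (-n) * weber z := weber_add_int z n

lemma im_add_int_pos {z : ℂ} (hz : 0 < z.im) (n : ℤ) : 0 < (z + n).im := by simpa using hz

lemma weber_fricke_add_int_fricke {z : ℂ} (hz : 0 < z.im) (n : ℤ) :
    weber (-1 / (2 * (-1 / (2 * z) + n))) = zeta n * weber z := by
  have h1 := im_fricke_pos hz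
  have h3 := weber_ne_zero hz
  have hs : ((√2 : ℝ) : ℂ) ≠ 0 := by simp
  rw [weber_fricke (im_add_int_pos h1 n), weber_add_int_eq, weber_fricke hz]
  have h4 : zeta (-n) * zeta n = 1 := by rw [← zeta_add, neg_add_cancel, zeta_zero]
  have := zeta_ne_zero (-n)
  field_simp
  linear_combination -h4

lemma int_mul_add_ne_zero {z : ℂ} (hz : 0 < z.im) (m : ℤ) {d : ℤ} (hd : d ≠ 0) :
    (m : ℂ) * z + d ≠ 0 := by
  intro h
  have h1 := congrArg im h
  simp only [add_im, mul_im, intCast_re, intCast_im, zero_mul, add_zero, zero_im, mul_eq_zero] at h1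
  rcases h1 with h1 | h1
  · have hm : m = 0 := by exact_mod_cast h1
    subst hm
    simp at h
    exact hd h
  · exact hz.ne' h1

lemma moebius_div {x y : ℂ} (hy : y ≠ 0) (a b c d : ℂ) :
    (a * (x / y) + b) / (c * (x / y) + d) = (a * x + b * y) / (c * x + d * y) := by
  rw [← mul_div_mul_right _ _ hy]
  congr 1 <;> field_simp

/-- The exponent of the multiplier of `η(z) / η(2z)` at the matrix `!![a, b; 2c, 2k+1]`. -/
def weberExp (a b c k : ℤ) : ℤ :=
  6 * (k * (k + 1)) + c * (a - 2 * (2 * k + 1)) - b * (2 * k + 1) * (2 * c ^ 2 + 1)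

lemma dvd_of_zmod {n : ℤ} (h8 : (n : ZMod 8) = 0) (h3 : (n : ZMod 3) = 0) : (24 : ℤ) ∣ n := by
  have h1 := (ZMod.intCast_zmod_eq_zero_iff_dvd n 8).1 h8
  have h2 := (ZMod.intCast_zmod_eq_zero_iff_dvd n 3).1 h3
  push_cast at h1 h2
  omega

lemma weberExp_T {a b c k : ℤ} (h : a * (2 * k + 1) - b * (2 * c) = 1) :
    (24 : ℤ) ∣ weberExp a (a + b) c (k + c) - (weberExp a b c k - 1) := by
  have h8 := congrArg (Int.cast : ℤ → ZMod 8) h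
  have h3 := congrArg (Int.cast : ℤ → ZMod 3) h
  push_cast at h8 h3
  apply dvd_of_zmod
  · simp only [weberExp]
    push_cast
    generalize (a : ZMod 8) = a at *
    generalize (b : ZMod 8) = b at *
    generalize (c : ZMod 8) = c at *
    generalize (k : ZMod 8) = k at *
    revert a b c k
    decide +kernel
  · simp only [weberExp]
    push_cast
    generalize (a : ZMod 3) = a at *
    generalize (b : ZMod 3) = b at *
    generalize (c : ZMod 3) = c at *
    generalize (k : ZMod 3) = k at *
    revert a b c k
    decide +kernel

lemma weberExp_V {a b c k : ℤ} (h : a * (2 * k + 1) - b * (2 * c) = 1) :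
    (24 : ℤ) ∣ weberExp (a + 2 * b) b (c + (2 * k + 1)) k - (weberExp a b c k - 1) := by
  have h8 := congrArg (Int.cast : ℤ → ZMod 8) h
  have h3 := congrArg (Int.cast : ℤ → ZMod 3) h
  push_cast at h8 h3
  apply dvd_of_zmod
  · simp only [weberExp]
    push_cast
    generalize (a : ZMod 8) = a at *
    generalize (b : ZMod 8) = b at *
    generalize (c : ZMod 8) = c at *
    generalize (k : ZMod 8) = k at *
    revert a b c k
    decide +kernel
  · simp only [weberExp]
    push_cast
    generalize (a : ZMod 3) = a at *
    generalize (b : ZMod 3) = b at *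
    generalize (c : ZMod 3) = c at *
    generalize (k : ZMod 3) = k at *
    revert a b c k
    decide +kernel

/-- The transformation law of `η(z) / η(2z)` at a given matrix of `Γ₀(2)`. -/
def WeberLaw (a b c k : ℤ) : Prop :=
  ∀ z : ℂ, 0 < z.im →
    weber ((a * z + b) / ((2 * c : ℤ) * z + (2 * k + 1 : ℤ))) = zeta (weberExp a b c k) * weber z

lemma WeberLaw.mul_T {a b c k : ℤ} (h : a * (2 * k + 1) - b * (2 * c) = 1)
    (H : WeberLaw a b c k) : WeberLaw a (a + b) c (k + c) := by
  intro z hz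
  rw [zeta_congr (weberExp_T h), sub_eq_add_neg, zeta_add, mul_assoc, ← weber_add_int_eq,
    ← H _ (im_add_int_pos hz 1)]
  push_cast; ring_nf

lemma WeberLaw.of_mul_T {a b c k : ℤ} (h : a * (2 * k + 1) - b * (2 * c) = 1)
    (H : WeberLaw a (a + b) c (k + c)) : WeberLaw a b c k := by
  intro z hz
  have h1 := H (z + (-1 : ℤ)) (im_add_int_pos hz (-1))
  rw [zeta_congr (weberExp_T h), weber_add_int_eq, ← mul_assoc, ← zeta_add, neg_neg,
    sub_add_cancel] at h1
  rw [← h1]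
  push_cast; ring_nf

lemma weber_V {z : ℂ} (hz : 0 < z.im) :
    0 < (z / (2 * z + 1)).im ∧ weber (z / (2 * z + 1)) = zeta (-1) * weber z := by
  have h0 := ne_zero_of_im_pos hz
  have h1 : 2 * z + 1 ≠ 0 := by simpa using int_mul_add_ne_zero hz 2 one_ne_zero
  have e : z / (2 * z + 1) = -1 / (2 * (-1 / (2 * z) + (-1 : ℤ))) := by
    push_cast
    rw [show 2 * (-1 / (2 * z) + -1) = -((2 * z + 1) / z) by field_simp; ring]
    field_simp
  rw [e]
  exact ⟨im_fricke_pos (im_add_int_pos (im_fricke_pos hz) _), weber_fricke_add_int_fricke hz _⟩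

lemma weber_V_inv {z : ℂ} (hz : 0 < z.im) :
    0 < (z / (-2 * z + 1)).im ∧ weber (z / (-2 * z + 1)) = zeta 1 * weber z := by
  have h0 := ne_zero_of_im_pos hz
  have h1 : -2 * z + 1 ≠ 0 := by simpa using int_mul_add_ne_zero hz (-2) one_ne_zero
  have e : z / (-2 * z + 1) = -1 / (2 * (-1 / (2 * z) + (1 : ℤ))) := by
    push_cast
    rw [show 2 * (-1 / (2 * z) + 1) = -((-2 * z + 1) / z) by field_simp; ring]
    field_simp
  rw [e]
  exact ⟨im_fricke_pos (im_add_int_pos (im_fricke_pos hz) _), weber_fricke_add_int_fricke hz _⟩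

lemma WeberLaw.mul_V {a b c k : ℤ} (h : a * (2 * k + 1) - b * (2 * c) = 1)
    (H : WeberLaw a b c k) : WeberLaw (a + 2 * b) b (c + (2 * k + 1)) k := by
  intro z hz
  obtain ⟨h1, h2⟩ := weber_V hz
  have h3 : 2 * z + 1 ≠ 0 := by simpa using int_mul_add_ne_zero hz 2 one_ne_zero
  rw [zeta_congr (weberExp_V h), sub_eq_add_neg, zeta_add, mul_assoc, ← h2, ← H _ h1,
    moebius_div h3]
  push_cast; ring_nf

lemma WeberLaw.of_mul_V {a b c k : ℤ} (h : a * (2 * k + 1) - b * (2 * c) = 1)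
    (H : WeberLaw (a + 2 * b) b (c + (2 * k + 1)) k) : WeberLaw a b c k := by
  intro z hz
  obtain ⟨h1, h2⟩ := weber_V_inv hz
  have h3 : -2 * z + 1 ≠ 0 := by simpa using int_mul_add_ne_zero hz (-2) one_ne_zero
  have h4 := H _ h1
  rw [zeta_congr (weberExp_V h), h2, ← mul_assoc, ← zeta_add, sub_add_cancel, moebius_div h3] at h4
  rw [← h4]
  push_cast; ring_nf

lemma weberLaw {a b c k : ℤ} (h : a * (2 * k + 1) - b * (2 * c) = 1) : WeberLaw a b c k := by
  induction hn : (2 * c).natAbs + (2 * k + 1).natAbs using Nat.strong_induction_on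
    generalizing a b c k with
  | _ n ih =>
  subst hn
  rcases eq_or_ne c 0 with rfl | hc
  · have h' : a * (2 * k + 1) = 1 := by linarith
    rcases Int.eq_one_or_neg_one_of_mul_eq_one' h' with ⟨rfl, hk⟩ | ⟨rfl, hk⟩
    · obtain rfl : k = 0 := by omega
      intro z hz
      have := weber_add_int_eq z b
      simpa [weberExp] using this
    · obtain rfl : k = -1 := by omega
      intro z hz
      have := weber_add_int_eq z (-b)
      simp only [weberExp]
      norm_num at this ⊢
      rw [← this]
      congr 1; ring
  rcases lt_or_gt_of_ne (show (2 * c).natAbs ≠ (2 * k + 1).natAbs by omega) with hlt | hlt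
  · by_cases hs : 0 < c ↔ 0 < 2 * k + 1
    · have h' : a * (2 * (k - c) + 1) - (b - a) * (2 * c) = 1 := by linear_combination h
      have := (ih _ (by omega) h' rfl).mul_T h'
      simpa using this
    · have h' : a * (2 * (k + c) + 1) - (a + b) * (2 * c) = 1 := by linear_combination h
      exact (ih _ (by omega) h' rfl).of_mul_T h
  · by_cases hs : 0 < c ↔ 0 < 2 * k + 1
    · have h' : (a - 2 * b) * (2 * k + 1) - b * (2 * (c - (2 * k + 1))) = 1 := by
        linear_combination h
      have := (ih _ (by omega) h' rfl).mul_V h'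
      simpa using this
    · have h' : (a + 2 * b) * (2 * k + 1) - b * (2 * (c + (2 * k + 1))) = 1 := by
        linear_combination h
      exact (ih _ (by omega) h' rfl).of_mul_V h

/-- The modular equation of degree 29, in the variables `B` and `A` below. -/
def modPoly (B A : ℂ) : ℂ :=
  B ^ 7 + 175 * B ^ 5 - 667 * B ^ 4 * A + 783 * B ^ 3 * A ^ 2 - 936 * B ^ 3 - 261 * B ^ 2 * A ^ 3 +
    4176 * B ^ 2 * A + 29 * B * A ^ 4 - 9280 * B * A ^ 2 - 6480 * B - A ^ 5 + 7448 * A ^ 3 +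
    9072 * A

/-- `X = (u(z) u(29 z)) ^ 2` for `u = weber`. -/
noncomputable def modProd (z : ℂ) : ℂ := (weber z * weber (29 * z)) ^ 2

/-- `R = (u(29 z) / u(z)) ^ 3` for `u = weber`. -/
noncomputable def modQuot (z : ℂ) : ℂ := (weber (29 * z) / weber z) ^ 3

/-- The left hand side of the modular equation of degree 29. -/
noncomputable def modEqn (z : ℂ) : ℂ :=
  modPoly (modProd z + 4 / modProd z) (modQuot z - 1 / modQuot z)

lemma modPoly_neg (B A : ℂ) : modPoly (-B) (-A) = -modPoly B A := by simp only [modPoly]; ring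

lemma im_29_mul_pos {z : ℂ} (hz : 0 < z.im) : 0 < (29 * z).im := by simpa using hz

lemma modProd_ne_zero {z : ℂ} (hz : 0 < z.im) : modProd z ≠ 0 :=
  pow_ne_zero _ (mul_ne_zero (weber_ne_zero hz) (weber_ne_zero (im_29_mul_pos hz)))

lemma modQuot_ne_zero {z : ℂ} (hz : 0 < z.im) : modQuot z ≠ 0 :=
  pow_ne_zero _ (div_ne_zero (weber_ne_zero (im_29_mul_pos hz)) (weber_ne_zero hz))

lemma zeta_mul_nat (n : ℕ) (m : ℤ) : zeta (n * m) = zeta m ^ n := by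
  rw [zeta, zeta, ← Complex.exp_nat_mul]; push_cast; ring_nf

lemma zeta_twelve_mul (n : ℤ) : zeta (12 * n) = 1 ∨ zeta (12 * n) = -1 := by
  rw [← sq_eq_one_iff, ← zeta_mul_nat, ← zeta_zero]
  exact zeta_congr ⟨n, by push_cast; ring⟩

lemma modPoly_sign {ε B A : ℂ} (hε : ε = 1 ∨ ε = -1) :
    ‖modPoly (ε * B) (ε * A)‖ = ‖modPoly B A‖ := by
  rcases hε with rfl | rfl
  · simp
  · rw [neg_one_mul, neg_one_mul, modPoly_neg, norm_neg]

lemma weberExp_gamma {a b c k : ℤ} (h : a * (2 * k + 1) - b * (58 * c) = 1) :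
    (24 : ℤ) ∣ weberExp a (29 * b) c k - 5 * weberExp a b (29 * c) k := by
  have h8 := congrArg (Int.cast : ℤ → ZMod 8) h
  have h3 := congrArg (Int.cast : ℤ → ZMod 3) h
  push_cast at h8 h3
  apply dvd_of_zmod
  · simp only [weberExp]
    push_cast
    generalize (a : ZMod 8) = a at *
    generalize (b : ZMod 8) = b at *
    generalize (c : ZMod 8) = c at *
    generalize (k : ZMod 8) = k at *
    revert a b c k
    decide +kernel
  · simp only [weberExp]
    push_cast
    generalize (a : ZMod 3) = a at *
    generalize (b : ZMod 3) = b at *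
    generalize (c : ZMod 3) = c at *
    generalize (k : ZMod 3) = k at *
    revert a b c k
    decide +kernel

lemma weberExp_atkinLehner {x y c k : ℤ} (h : 29 * x * (2 * k + 1) - 2 * c * y = 1) :
    (24 : ℤ) ∣ weberExp (29 * x) y c k - (12 + 5 * weberExp x y c (29 * k + 14)) := by
  have h8 := congrArg (Int.cast : ℤ → ZMod 8) h
  have h3 := congrArg (Int.cast : ℤ → ZMod 3) h
  push_cast at h8 h3
  apply dvd_of_zmod
  · simp only [weberExp]
    push_cast
    generalize (x : ZMod 8) = x at *
    generalize (y : ZMod 8) = y at *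
    generalize (c : ZMod 8) = c at *
    generalize (k : ZMod 8) = k at *
    revert x y c k
    decide +kernel
  · simp only [weberExp]
    push_cast
    generalize (x : ZMod 3) = x at *
    generalize (y : ZMod 3) = y at *
    generalize (c : ZMod 3) = c at *
    generalize (k : ZMod 3) = k at *
    revert x y c k
    decide +kernel

/-- Invariance under `Γ₀(58)`. -/
lemma norm_modEqn_gamma {a b c k : ℤ} (h : a * (2 * k + 1) - b * (58 * c) = 1) {z : ℂ}
    (hz : 0 < z.im) :
    ‖modEqn ((a * z + b) / ((58 * c : ℤ) * z + (2 * k + 1 : ℤ)))‖ = ‖modEqn z‖ := by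
  have h1 := weberLaw (a := a) (b := b) (c := 29 * c) (k := k) (by linear_combination h) z hz
  have h2 := weberLaw (a := a) (b := 29 * b) (c := c) (k := k) (by linear_combination h) (29 * z)
    (im_29_mul_pos hz)
  rw [show (2 * (29 * c) : ℤ) = 58 * c by ring] at h1
  rw [show (a * (29 * z) + (29 * b : ℤ)) / ((2 * c : ℤ) * (29 * z) + (2 * k + 1 : ℤ)) =
    29 * ((a * z + b) / ((58 * c : ℤ) * z + (2 * k + 1 : ℤ))) by push_cast; ring] at h2
  have hE : zeta (weberExp a (29 * b) c k) = zeta (weberExp a b (29 * c) k) ^ 5 := by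
    rw [← zeta_mul_nat]
    exact zeta_congr (weberExp_gamma h)
  have hε := zeta_twelve_mul (weberExp a b (29 * c) k)
  rw [show (12 : ℤ) = ((12 : ℕ) : ℤ) from rfl, zeta_mul_nat] at hε
  generalize zeta (weberExp a b (29 * c) k) = e at *
  rw [hE] at h2
  have hX := modProd_ne_zero hz
  have hR := modQuot_ne_zero hz
  have e1 : modProd ((a * z + b) / ((58 * c : ℤ) * z + (2 * k + 1 : ℤ))) = e ^ 12 * modProd z := by
    rw [modProd, modProd, h1, h2]; ring
  have he : e ≠ 0 := by rintro rfl; simp at hε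
  have e2 : modQuot ((a * z + b) / ((58 * c : ℤ) * z + (2 * k + 1 : ℤ))) = e ^ 12 * modQuot z := by
    have := weber_ne_zero hz
    rw [modQuot, modQuot, h1, h2]; field_simp
  rw [modEqn, modEqn, e1, e2, ← modPoly_sign hε]
  congr 2 <;> rcases hε with h | h <;> rw [h] <;> field_simp <;> try ring

lemma norm_modEqn_add_one {z : ℂ} (hz : 0 < z.im) : ‖modEqn (z + 1)‖ = ‖modEqn z‖ := by
  have := norm_modEqn_gamma (a := 1) (b := 1) (c := 0) (k := 0) (by norm_num) hz
  simpa using this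

/-- Invariance under the Atkin–Lehner involutions at 29. -/
lemma norm_modEqn_atkinLehner {x y c k : ℤ} (h : 29 * x * (2 * k + 1) - 2 * c * y = 1) {z : ℂ}
    (hz : 0 < z.im) :
    ‖modEqn (((29 * x : ℤ) * z + y) / ((58 * c : ℤ) * z + (29 * (2 * k + 1) : ℤ)))‖ =
      ‖modEqn z‖ := by
  have h1 := weberLaw (a := x) (b := y) (c := c) (k := 29 * k + 14) (by linear_combination h)
    (29 * z) (im_29_mul_pos hz)
  have h2 := weberLaw (a := 29 * x) (b := y) (c := c) (k := k) (by linear_combination h) z hz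
  set w := ((29 * x : ℤ) * z + y) / ((58 * c : ℤ) * z + (29 * (2 * k + 1) : ℤ)) with hw
  rw [show (x * (29 * z) + y) / ((2 * c : ℤ) * (29 * z) + (2 * (29 * k + 14) + 1 : ℤ)) = w by
    rw [hw]; push_cast; ring] at h1
  rw [show ((29 * x : ℤ) * z + y) / ((2 * c : ℤ) * z + (2 * k + 1 : ℤ)) = 29 * w by
    rw [hw, ← mul_div_assoc, ← mul_div_mul_left _ _ (show (29 : ℂ) ≠ 0 by norm_num)]
    push_cast; ring] at h2
  have hE : zeta (weberExp (29 * x) y c k) = -zeta (weberExp x y c (29 * k + 14)) ^ 5 := by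
    have h12 : zeta 12 = -1 := by
      rw [zeta, ← Complex.exp_pi_mul_I]; push_cast; ring_nf
    rw [← zeta_mul_nat, neg_eq_neg_one_mul, ← h12, ← zeta_add]
    exact zeta_congr (weberExp_atkinLehner h)
  have hε := zeta_twelve_mul (weberExp x y c (29 * k + 14))
  rw [show (12 : ℤ) = ((12 : ℕ) : ℤ) from rfl, zeta_mul_nat] at hε
  generalize zeta (weberExp x y c (29 * k + 14)) = e at *
  rw [hE] at h2
  have hX := modProd_ne_zero hz
  have hR := modQuot_ne_zero hz
  have e1 : modProd w = e ^ 12 * modProd z := by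
    rw [modProd, modProd, h1, h2]; ring
  have he : e ≠ 0 := by rintro rfl; simp at hε
  have e2 : modQuot w = -e ^ 12 / modQuot z := by
    have := weber_ne_zero hz
    have := weber_ne_zero (im_29_mul_pos hz)
    rw [modQuot, modQuot, h1, h2]; field_simp
  rw [modEqn, modEqn, e1, e2, ← modPoly_sign hε]
  congr 2 <;> rcases hε with h | h <;> rw [h] <;> field_simp <;> ring

/-- Invariance under the Fricke involution of level 58. -/
lemma norm_modEqn_fricke {z : ℂ} (hz : 0 < z.im) : ‖modEqn (-1 / (58 * z))‖ = ‖modEqn z‖ := by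
  have h1 := weber_fricke (im_29_mul_pos hz)
  have h2 := weber_fricke hz
  have h0 := ne_zero_of_im_pos hz
  have u1 := weber_ne_zero hz
  have u2 := weber_ne_zero (im_29_mul_pos hz)
  rw [show -1 / (2 * (29 * z)) = -1 / (58 * z) by ring] at h1
  rw [show -1 / (2 * z) = 29 * (-1 / (58 * z)) by field_simp; norm_num] at h2
  have hs : ((√2 : ℝ) : ℂ) ≠ 0 := by simp
  have hs4 : ((√2 : ℝ) : ℂ) ^ 4 = 4 := by
    rw [← Complex.ofReal_pow, show (√2 : ℝ) ^ 4 = 4 by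
      rw [show (4 : ℕ) = 2 * 2 from rfl, pow_mul, Real.sq_sqrt zero_le_two]; norm_num]
    simp
  have e1 : modProd (-1 / (58 * z)) = 4 / modProd z := by
    rw [modProd, modProd, h1, h2, ← hs4]; field_simp
  have e2 : modQuot (-1 / (58 * z)) = modQuot z := by
    rw [modQuot, modQuot, h1, h2]; field_simp
  have hX := modProd_ne_zero hz
  rw [modEqn, modEqn, e1, e2]
  congr 2; field_simp; ring

lemma im_moebius (a b c d : ℤ) (z : ℂ) :
    ((a * z + b) / (c * z + d)).im = (a * d - b * c) * z.im / normSq (c * z + d) := by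
  rw [Complex.div_im]; simp; ring

lemma exists_coprime_pair {z : ℂ} (hz : 0 < z.im) :
    ∃ c d : ℤ, IsCoprime c d ∧ normSq (c * z + d) ≤ 2 * z.im ∧ (c : ℂ) * z + d ≠ 0 := by
  obtain ⟨g, hg⟩ := ModularGroup.exists_smul_mem_fd ⟨z, hz⟩
  have h := ModularGroup.three_le_four_mul_im_sq_of_mem_fd hg
  have hd := UpperHalfPlane.denom_ne_zero g ⟨z, hz⟩
  refine ⟨g 1 0, g 1 1, ?_, ?_, ?_⟩
  · have := Matrix.SpecialLinearGroup.det_coe g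
    rw [Matrix.det_fin_two] at this
    exact ⟨-g 0 1, g 0 0, by linear_combination this⟩
  · have := ModularGroup.im_smul_eq_div_normSq g ⟨z, hz⟩
    rw [ModularGroup.denom_apply] at this hd
    have h2 := normSq_pos.2 hd
    have h4 : 1 / 2 ≤ (g • (⟨z, hz⟩ : UpperHalfPlane)).im := by
      have := (g • (⟨z, hz⟩ : UpperHalfPlane)).im_pos
      nlinarith
    rw [this, le_div_iff₀ h2] at h4
    change 1 / 2 * normSq (g 1 0 * z + g 1 1) ≤ z.im at h4
    linarith
  · rw [ModularGroup.denom_apply] at hd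
    simpa using hd

/-- Every orbit of the group generated by `Γ₀(58)` and its Atkin–Lehner involutions meets
the half plane `1 / 116 ≤ im z`. -/
lemma exists_modEqn_reduction {z : ℂ} (hz : 0 < z.im) :
    ∃ w : ℂ, 1 / 116 ≤ w.im ∧ ‖modEqn w‖ = ‖modEqn z‖ := by
  obtain ⟨c, d, hcd, hle, hne⟩ := exists_coprime_pair hz
  have hpos : 0 < normSq (c * z + d) := normSq_pos.2 hne
  have hp29 : Prime (29 : ℤ) := by norm_num
  rcases Int.even_or_odd' c with ⟨c', rfl | hc⟩
  · have hd : IsCoprime 2 d := (IsCoprime.mul_left_iff.1 hcd).1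
    obtain ⟨k, rfl⟩ : ∃ k, d = 2 * k + 1 := by
      rcases Int.even_or_odd' d with ⟨k, hk | hk⟩
      · obtain ⟨p, q, h⟩ := hd
        subst hk
        have : 2 * (p + q * k) = 1 := by linear_combination h
        omega
      · exact ⟨k, hk⟩
    by_cases h29 : (29 : ℤ) ∣ c'
    · obtain ⟨e, rfl⟩ := h29
      obtain ⟨p, q, h⟩ := hcd
      refine ⟨_, ?_, norm_modEqn_gamma (a := q) (b := -p) (c := e) (k := k)
        (by linear_combination h) hz⟩
      rw [im_moebius, show (58 * e : ℤ) = 2 * (29 * e) by ring, le_div_iff₀ hpos]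
      have h' := congrArg (Int.cast : ℤ → ℝ) h
      push_cast at h' ⊢
      rw [show (q * (2 * k + 1) - -p * (2 * (29 * e)) : ℝ) = 1 by linear_combination h']
      push_cast at hle
      linarith
    · have hc29 : IsCoprime (2 * c') 29 :=
        ((Prime.coprime_iff_not_dvd hp29).2 fun h => h29 (by omega)).symm
      obtain ⟨p, q, h⟩ := IsCoprime.mul_right hc29 hcd
      refine ⟨_, ?_, norm_modEqn_atkinLehner (x := q) (y := -p) (c := c') (k := k)
        (by linear_combination h) hz⟩
      rw [im_moebius]
      have h' := congrArg (Int.cast : ℤ → ℝ) h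
      push_cast at h' ⊢
      rw [show (29 * q * (29 * (2 * k + 1)) - -p * (58 * c') : ℝ) = 29 by
        linear_combination 29 * h',
        show (58 * c' * z + 29 * (2 * k + 1) : ℂ) = 29 * (2 * c' * z + (2 * k + 1)) by ring,
        normSq_mul]
      push_cast at hle hpos
      rw [le_div_iff₀ (mul_pos (by norm_num) hpos)]
      norm_num
      linarith
  · have hc2 : IsCoprime c 2 := ⟨1, -c', by omega⟩
    by_cases h29 : (29 : ℤ) ∣ c
    · obtain ⟨e, rfl⟩ := h29
      obtain ⟨p, q, h⟩ := IsCoprime.mul_right hc2 hcd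
      obtain ⟨m, rfl⟩ : ∃ m, p = -(2 * m + 1) := by
        rcases Int.even_or_odd' p with ⟨k, hk | hk⟩
        · subst hk
          have : 2 * (k * (29 * e) + q * d) = 1 := by linear_combination h
          omega
        · exact ⟨-k - 1, by omega⟩
      have hdet : 29 * (-e) * (2 * m + 1) - 2 * q * (-d) = 1 := by linear_combination h
      set w := (((29 * -e : ℤ) : ℂ) * z + (-d : ℤ)) /
        ((58 * q : ℤ) * z + (29 * (2 * m + 1) : ℤ)) with hw
      have hn := norm_modEqn_atkinLehner hdet hz
      have hden : ((58 * q : ℤ) : ℂ) * z + (29 * (2 * m + 1) : ℤ) ≠ 0 :=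
        int_mul_add_ne_zero hz _ (by omega)
      have hwim : 0 < w.im := by
        rw [hw, im_moebius]
        have h' := congrArg (Int.cast : ℤ → ℝ) hdet
        push_cast at h' ⊢
        rw [show (29 * -e * (29 * (2 * m + 1)) - -d * (58 * q) : ℝ) = 29 by
          linear_combination 29 * h']
        have := normSq_pos.2 hden
        push_cast at this
        positivity
      refine ⟨-1 / (58 * w), ?_, (norm_modEqn_fricke hwim).trans hn⟩
      have hww : -1 / (58 * w) = ((58 * q : ℤ) * z + (29 * (2 * m + 1) : ℤ)) /
          ((58 * (29 * e) : ℤ) * z + (58 * d : ℤ)) := by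
        rw [hw]
        push_cast at hden hne ⊢
        have h2 : -(29 * e * z) + -d ≠ 0 := by
          rw [← neg_add]; exact neg_ne_zero.2 hne
        rw [show (58 * (29 * e) * z + 58 * d : ℂ) = -58 * (29 * -e * z + -d) by ring]
        rw [← mul_div_assoc, div_div_eq_mul_div, neg_one_mul, neg_mul, div_neg, neg_div]
      rw [hww, im_moebius]
      have h' := congrArg (Int.cast : ℤ → ℝ) hdet
      push_cast at h' hle hpos ⊢
      rw [show (58 * q * (58 * d) - 29 * (2 * m + 1) * (58 * (29 * e)) : ℝ) = 58 * 29 by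
        linear_combination 58 * 29 * h',
        show (58 * (29 * e) * z + 58 * d : ℂ) = 58 * (29 * e * z + d) by ring, normSq_mul]
      rw [le_div_iff₀ (mul_pos (by norm_num) hpos)]
      norm_num
      linarith
    · have hc58 : IsCoprime c (2 * 29) :=
        hc2.mul_right ((Prime.coprime_iff_not_dvd hp29).2 h29).symm
      obtain ⟨p, q, h⟩ := IsCoprime.mul_right hc58 hcd
      obtain ⟨m, rfl⟩ : ∃ m, p = -(2 * m + 1) := by
        rcases Int.even_or_odd' p with ⟨k, hk | hk⟩
        · subst hk
          have : 2 * (k * c + 29 * q * d) = 1 := by linear_combination h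
          omega
        · exact ⟨-k - 1, by omega⟩
      have hdet : -c * (2 * m + 1) - (-d) * (58 * q) = 1 := by linear_combination h
      set w := (((-c : ℤ) : ℂ) * z + (-d : ℤ)) /
        ((58 * q : ℤ) * z + (2 * m + 1 : ℤ)) with hw
      have hn := norm_modEqn_gamma hdet hz
      have hden : ((58 * q : ℤ) : ℂ) * z + (2 * m + 1 : ℤ) ≠ 0 :=
        int_mul_add_ne_zero hz _ (by omega)
      have hwim : 0 < w.im := by
        rw [hw, im_moebius]
        have h' := congrArg (Int.cast : ℤ → ℝ) hdet
        push_cast at h' ⊢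
        rw [h']
        have := normSq_pos.2 hden
        push_cast at this
        positivity
      refine ⟨-1 / (58 * w), ?_, (norm_modEqn_fricke hwim).trans hn⟩
      have hww : -1 / (58 * w) = ((58 * q : ℤ) * z + (2 * m + 1 : ℤ)) /
          ((58 * c : ℤ) * z + (58 * d : ℤ)) := by
        rw [hw]
        push_cast
        rw [show (58 * c * z + 58 * d : ℂ) = -(58 * (-c * z + -d)) by ring]
        rw [← mul_div_assoc, div_div_eq_mul_div, neg_one_mul, div_neg, neg_div]
      rw [hww, im_moebius]
      have h' := congrArg (Int.cast : ℤ → ℝ) hdet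
      push_cast at h' hle hpos ⊢
      rw [show (58 * q * (58 * d) - (2 * m + 1) * (58 * c) : ℝ) = 58 by
        linear_combination 58 * h',
        show (58 * c * z + 58 * d : ℂ) = 58 * (c * z + d) by ring, normSq_mul]
      rw [le_div_iff₀ (mul_pos (by norm_num) hpos)]
      norm_num
      linarith

/-- The polynomial with the given list of coefficients. -/
noncomputable def evalList : List ℤ → ℂ → ℂ
  | [], _ => 0
  | a :: l, q => a + q * evalList l q

/-- Addition of polynomials given by coefficient lists. -/
def addList : List ℤ → List ℤ → List ℤ
  | [], m => m
  | l, [] => l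
  | a :: l, b :: m => (a + b) :: addList l m

/-- Multiplication of polynomials given by coefficient lists. -/
def mulList : List ℤ → List ℤ → List ℤ
  | [], _ => []
  | a :: l, m => addList (m.map (a * ·)) (0 :: mulList l m)

/-- Multiplication of power series truncated at order 18. -/
def mulTrunc (l m : List ℤ) : List ℤ := (mulList l m).take 18

/-- The substitution `q ↦ q ^ 2` on coefficient lists. -/
def spreadList : List ℤ → List ℤ
  | [] => []
  | a :: l => a :: 0 :: spreadList l

lemma evalList_addList (l m : List ℤ) (q : ℂ) :
    evalList (addList l m) q = evalList l q + evalList m q := by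
  induction l, m using addList.induct with
  | case1 m => simp [addList, evalList]
  | case2 l h => cases l <;> simp [addList, evalList]
  | case3 a l b m ih => simp only [addList, evalList, ih]; push_cast; ring

lemma evalList_map (a : ℤ) (l : List ℤ) (q : ℂ) :
    evalList (l.map (a * ·)) q = a * evalList l q := by
  induction l with
  | nil => simp [evalList]
  | cons b l ih => simp only [List.map_cons, evalList, ih]; push_cast; ring

lemma evalList_mulList (l m : List ℤ) (q : ℂ) :
    evalList (mulList l m) q = evalList l q * evalList m q := by
  induction l with
  | nil => simp [mulList, evalList]
  | cons a l ih =>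
    simp only [mulList, evalList_addList, evalList_map, evalList, ih]; push_cast; ring

lemma evalList_spreadList (l : List ℤ) (q : ℂ) :
    evalList (spreadList l) q = evalList l (q ^ 2) := by
  induction l with
  | nil => simp [spreadList, evalList]
  | cons a l ih => simp only [spreadList, evalList, ih]; push_cast; ring

lemma evalList_take (n : ℕ) (l : List ℤ) (q : ℂ) :
    evalList l q = evalList (l.take n) q + q ^ n * evalList (l.drop n) q := by
  induction n generalizing l with
  | zero => simp [evalList]
  | succ n ih =>
    cases l with
    | nil => simp [evalList]
    | cons a l => simp only [List.take_succ_cons, List.drop_succ_cons, evalList]; rw [ih l]; ring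

lemma evalList_replicate (n : ℕ) (l : List ℤ) (q : ℂ) :
    evalList (List.replicate n 0 ++ l) q = q ^ n * evalList l q := by
  induction n with
  | zero => simp
  | succ n ih => simp only [List.replicate_succ, List.cons_append, evalList, ih]; push_cast; ring

lemma evalList_eq_zero {l : List ℤ} (h : ∀ a ∈ l, a = 0) (q : ℂ) : evalList l q = 0 := by
  induction l with
  | nil => rfl
  | cons a l ih => simp_all [evalList]

lemma continuous_evalList (l : List ℤ) : Continuous (evalList l) := by
  induction l with
  | nil => exact continuous_const
  | cons a l ih => exact continuous_const.add (continuous_id.mul ih)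

/-- `f` agrees with the polynomial with coefficients `l` up to order 18 at the origin. -/
def HasJet (f : ℂ → ℂ) (l : List ℤ) : Prop :=
  (fun q => f q - evalList l q) =O[𝓝 0] fun q => q ^ 18

lemma isBigO_one_of_continuousAt {f : ℂ → ℂ} (hf : ContinuousAt f 0) :
    f =O[𝓝 0] fun _ => (1 : ℂ) := hf.isBigO_one ℂ

lemma isBigO_pow_mul {f g : ℂ → ℂ} (hf : f =O[𝓝 0] fun q => q ^ 18)
    (hg : g =O[𝓝 0] fun _ => (1 : ℂ)) : (fun q => f q * g q) =O[𝓝 0] fun q => q ^ 18 := by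
  simpa using hf.mul hg

lemma evalList_isBigO (l : List ℤ) : evalList l =O[𝓝 0] fun _ => (1 : ℂ) :=
  isBigO_one_of_continuousAt (continuous_evalList l).continuousAt

lemma HasJet.isBigO_one {f : ℂ → ℂ} {l : List ℤ} (h : HasJet f l) :
    f =O[𝓝 0] fun _ => (1 : ℂ) := by
  have h1 : (fun q : ℂ => q ^ 18) =O[𝓝 0] fun _ => (1 : ℂ) :=
    isBigO_one_of_continuousAt (continuous_pow 18).continuousAt
  simpa using (h.trans h1).add (evalList_isBigO l)

lemma hasJet_evalList (l : List ℤ) : HasJet (evalList l) l := by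
  simpa [HasJet] using Asymptotics.isBigO_zero _ _

lemma HasJet.congr {f g : ℂ → ℂ} {l : List ℤ} (h : HasJet f l) (hfg : f =ᶠ[𝓝 0] g) :
    HasJet g l :=
  Asymptotics.IsBigO.congr' h (hfg.mono fun q hq => by simp [hq]) (EventuallyEq.refl _ _)

lemma HasJet.congr_list {f : ℂ → ℂ} {l m : List ℤ} (h : HasJet f l) (e : l = m) : HasJet f m :=
  e ▸ h

lemma HasJet.take {f : ℂ → ℂ} {l : List ℤ} (h : HasJet f l) : HasJet f (l.take 18) := by
  have h1 := h.add (isBigO_pow_mul (Asymptotics.isBigO_refl _ _) (evalList_isBigO (l.drop 18)))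
  refine h1.congr_left fun q => ?_
  rw [evalList_take 18 l]; ring

lemma HasJet.of_take {f : ℂ → ℂ} {l : List ℤ} (h : HasJet f (l.take 18)) : HasJet f l := by
  have h1 := h.sub (isBigO_pow_mul (Asymptotics.isBigO_refl _ _) (evalList_isBigO (l.drop 18)))
  refine h1.congr_left fun q => ?_
  rw [evalList_take 18 l]; ring

lemma HasJet.add {f g : ℂ → ℂ} {l m : List ℤ} (hf : HasJet f l) (hg : HasJet g m) :
    HasJet (fun q => f q + g q) (addList l m) := by
  refine (Asymptotics.IsBigO.add hf hg).congr_left fun q => ?_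
  rw [evalList_addList]; ring

lemma HasJet.mul {f g : ℂ → ℂ} {l m : List ℤ} (hf : HasJet f l) (hg : HasJet g m) :
    HasJet (fun q => f q * g q) (mulTrunc l m) := by
  refine HasJet.take ?_
  refine ((isBigO_pow_mul hf hg.isBigO_one).add
    (isBigO_pow_mul hg (evalList_isBigO l))).congr_left fun q => ?_
  rw [evalList_mulList]; ring

lemma HasJet.const_mul {f : ℂ → ℂ} {l : List ℤ} (hf : HasJet f l) (a : ℤ) :
    HasJet (fun q => a * f q) (l.map (a * ·)) := by
  refine (Asymptotics.IsBigO.const_mul_left hf (a : ℂ)).congr_left fun q => ?_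
  rw [evalList_map]; ring

lemma HasJet.pow_mul {f : ℂ → ℂ} {l : List ℤ} (hf : HasJet f l) (n : ℕ) :
    HasJet (fun q => q ^ n * f q) ((List.replicate n 0 ++ l).take 18) := by
  refine HasJet.take ?_
  have h1 : (fun q : ℂ => q ^ n) =O[𝓝 0] fun _ => (1 : ℂ) :=
    isBigO_one_of_continuousAt (continuous_pow n).continuousAt
  refine (isBigO_pow_mul hf h1).congr_left fun q => ?_
  rw [evalList_replicate]; ring

/-- Division of jets, with the quotient given. -/
lemma HasJet.of_mul {f g : ℂ → ℂ} {l m : List ℤ} (n : List ℤ)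
    (hfg : HasJet (fun q => f q * g q) m) (hg : HasJet g l) (hc : ContinuousAt g 0)
    (h0 : g 0 ≠ 0) (h : mulTrunc n l = m.take 18) : HasJet f n := by
  have h1 : HasJet (fun q => evalList n q * g q) m :=
    HasJet.of_take (h ▸ (hasJet_evalList n).mul hg)
  have h2 : (fun q => (f q - evalList n q) * g q) =O[𝓝 0] fun q => q ^ 18 :=
    (hfg.sub h1).congr_left fun q => by ring
  refine (isBigO_pow_mul h2 (isBigO_one_of_continuousAt (hc.inv₀ h0))).congr' ?_
    (EventuallyEq.refl _ _)
  filter_upwards [hc.eventually_ne h0] with q hq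
  exact mul_inv_cancel_right₀ hq _

lemma HasJet.inv {g : ℂ → ℂ} {l : List ℤ} (n : List ℤ) (hg : HasJet g l)
    (hc : ContinuousAt g 0) (h0 : g 0 ≠ 0) (h : mulTrunc n l = 1 :: List.replicate 17 0) :
    HasJet (fun q => (g q)⁻¹) n := by
  refine HasJet.of_mul (m := 1 :: List.replicate 17 0) n ?_ hg hc h0 h
  refine (hasJet_evalList _).congr ?_
  filter_upwards [hc.eventually_ne h0] with q hq
  rw [inv_mul_cancel₀ hq]
  simp [List.replicate, evalList]

lemma HasJet.comp_sq {f : ℂ → ℂ} {l : List ℤ} (hf : HasJet f l) :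
    HasJet (fun q => f (q ^ 2)) (spreadList l) := by
  have ht : Tendsto (fun q : ℂ => q ^ 2) (𝓝 0) (𝓝 0) := by
    simpa using (continuous_pow 2).tendsto (0 : ℂ)
  have h1 := hf.comp_tendsto ht
  have h2 : (fun q : ℂ => (q ^ 2) ^ 18) =O[𝓝 0] fun q => q ^ 18 := by
    refine (isBigO_pow_mul (Asymptotics.isBigO_refl _ _)
      (isBigO_one_of_continuousAt (continuous_pow 18).continuousAt)).congr_left fun q => ?_
    ring
  refine (h1.trans h2).congr_left fun q => ?_
  simp [evalList_spreadList]

/-- The truncation of `∏_{n ≤ N} (1 - q ^ n)`. -/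
def eulerList : ℕ → List ℤ
  | 0 => [1]
  | N + 1 => mulTrunc (eulerList N) (1 :: (List.replicate N 0 ++ [-1]))

lemma hasJet_prod (N : ℕ) :
    HasJet (fun q => ∏ n ∈ Finset.range N, (1 - q ^ (n + 1))) (eulerList N) := by
  induction N with
  | zero =>
    refine (hasJet_evalList [1]).congr (Eventually.of_forall fun q => ?_)
    simp [evalList]
  | succ N ih =>
    refine (ih.mul (hasJet_evalList _)).congr (Eventually.of_forall fun q => ?_)
    simp only [Finset.prod_range_succ, evalList, evalList_replicate]
    push_cast; ring

lemma eventually_mem_ball {r : ℝ} (hr : 0 < r) : ∀ᶠ q : ℂ in 𝓝 0, q ∈ Metric.ball (0 : ℂ) r :=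
  Metric.ball_mem_nhds 0 hr

lemma hasJet_euler_tail : HasJet (fun q => ∏' n : ℕ, (1 - q ^ (n + 18))) [1] := by
  refine Asymptotics.IsBigO.of_bound 4 ?_
  filter_upwards [eventually_mem_ball (r := 1 / 4) (by norm_num)] with q hq
  rw [mem_ball_zero_iff] at hq
  have h0 := norm_nonneg q
  have h1 := norm_tprod_sub_one_le (by linarith : ‖q‖ < 1) 18
  have h2 : ‖q‖ ^ 18 ≤ ‖q‖ := pow_le_of_le_one h0 (by linarith) (by norm_num)
  have h3 : ‖q‖ ^ 18 / (1 - ‖q‖) ≤ 2 * ‖q‖ ^ 18 := by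
    rw [div_le_iff₀ (by linarith)]; nlinarith [pow_nonneg h0 18]
  have h5 : 0 ≤ ‖q‖ ^ 18 / (1 - ‖q‖) := div_nonneg (by positivity) (by linarith)
  have h4 := exp_sub_one_le (s := ‖q‖ ^ 18 / (1 - ‖q‖)) (by linarith)
  simp only [evalList]
  rw [norm_pow]
  simp only [Int.cast_one, mul_zero, add_zero]
  refine h1.trans (h4.trans ?_)
  rw [div_le_iff₀ (by linarith)]
  nlinarith

lemma hasJet_euler : HasJet euler (mulTrunc (eulerList 17) [1]) := by
  refine ((hasJet_prod 17).mul hasJet_euler_tail).congr ?_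
  filter_upwards [eventually_mem_ball one_pos] with q hq
  have := (multipliable_one_sub_pow_add (mem_ball_zero_iff.1 hq) 18)
  rw [euler]
  exact Multipliable.prod_mul_tprod_nat_mul' (f := fun n => 1 - q ^ (n + 1)) (k := 17)
    (by simpa [add_assoc] using this)

lemma continuousAt_eulerOdd : ContinuousAt eulerOdd 0 :=
  (differentiableAt_of_ball differentiableOn_eulerOdd zero_mem_unit_ball).continuousAt

lemma continuousAt_euler_zero : ContinuousAt euler 0 :=
  (differentiableAt_of_ball differentiableOn_euler zero_mem_unit_ball).continuousAt

lemma euler_zero : euler 0 = 1 := by simp [euler]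

lemma hasJet_eulerOdd : HasJet eulerOdd
    [1, -1, 0, -1, 1, -1, 1, -1, 2, -2, 2, -2, 3, -3, 3, -4, 5, -5] := by
  have hc : ContinuousAt (fun q : ℂ => euler (q ^ 2)) 0 :=
    continuousAt_euler_zero.comp_of_eq (continuous_pow 2).continuousAt (by simp)
  refine HasJet.of_mul _ (hasJet_euler.congr ?_) hasJet_euler.comp_sq hc
    (by simp [euler_zero]) (by decide +kernel)
  filter_upwards [eventually_mem_ball one_pos] with q hq
  rw [eulerOdd, div_mul_cancel₀ _ (euler_sq_ne_zero hq)]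

lemma hasJet_eulerOdd_inv : HasJet (fun q => (eulerOdd q)⁻¹)
    [1, 1, 1, 2, 2, 3, 4, 5, 6, 8, 10, 12, 15, 18, 22, 27, 32, 38] :=
  hasJet_eulerOdd.inv _ continuousAt_eulerOdd (by simp [eulerOdd_zero]) (by decide +kernel)

lemma continuousAt_eulerOdd_pow : ContinuousAt (fun q : ℂ => eulerOdd (q ^ 29)) 0 :=
  continuousAt_eulerOdd.comp_of_eq (continuous_pow 29).continuousAt (by simp)

lemma hasJet_eulerOdd_pow : HasJet (fun q => eulerOdd (q ^ 29)) [1] := by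
  have ht : Tendsto (fun q : ℂ => q ^ 29) (𝓝 0) (𝓝 0) := by
    simpa using (continuous_pow 29).tendsto (0 : ℂ)
  have h1 := (isBigO_of_differentiableAt
    ((differentiableAt_of_ball differentiableOn_eulerOdd zero_mem_unit_ball).sub_const 1)
    (by simp [eulerOdd_zero])).comp_tendsto ht
  have h2 : (fun q : ℂ => (q ^ 29) ^ (0 + 1)) =O[𝓝 0] fun q => q ^ 18 := by
    refine (isBigO_pow_mul (Asymptotics.isBigO_refl _ _)
      (isBigO_one_of_continuousAt (continuous_pow 11).continuousAt)).congr_left fun q => ?_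
    ring
  refine (h1.trans h2).congr_left fun q => ?_
  simp [evalList]

lemma hasJet_eulerOdd_pow_inv : HasJet (fun q => (eulerOdd (q ^ 29))⁻¹)
    (1 :: List.replicate 17 0) :=
  (hasJet_eulerOdd_pow.inv _ continuousAt_eulerOdd_pow
    (by simp [eulerOdd_zero]) (by decide +kernel))

/-- The leading factor of `X + 4 / X`, as a function of the nome. -/
noncomputable def modSum (q : ℂ) : ℂ :=
  (eulerOdd q * eulerOdd (q ^ 29)) * (eulerOdd q * eulerOdd (q ^ 29)) +
    (4 : ℤ) * (q ^ 5 * (((eulerOdd q)⁻¹ * (eulerOdd (q ^ 29))⁻¹) *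
      ((eulerOdd q)⁻¹ * (eulerOdd (q ^ 29))⁻¹)))

/-- The leading factor of `R - 1 / R`, as a function of the nome. -/
noncomputable def modDiff (q : ℂ) : ℂ :=
  (eulerOdd (q ^ 29) * (eulerOdd q)⁻¹) *
      ((eulerOdd (q ^ 29) * (eulerOdd q)⁻¹) * (eulerOdd (q ^ 29) * (eulerOdd q)⁻¹)) +
    (-1 : ℤ) * (q ^ 7 * ((eulerOdd q * (eulerOdd (q ^ 29))⁻¹) *
      ((eulerOdd q * (eulerOdd (q ^ 29))⁻¹) * (eulerOdd q * (eulerOdd (q ^ 29))⁻¹))))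

lemma hasJet_modSum : HasJet modSum
    [1, -2, 1, -2, 4, 0, 13, 6, 33, 24, 69, 72, 149, 158, 293, 336, 558, 650] := by
  have h1 := hasJet_eulerOdd.mul hasJet_eulerOdd_pow
  have h2 := hasJet_eulerOdd_inv.mul hasJet_eulerOdd_pow_inv
  have h3 := (h1.mul h1).add (((h2.mul h2).pow_mul 5).const_mul 4)
  exact h3.congr_list (by decide +kernel)

lemma hasJet_modDiff : HasJet modDiff
    [1, 3, 6, 13, 24, 42, 73, 119, 195, 299, 469, 693, 1058, 1521, 2247, 3165, 4579, 6324] := by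
  have h1 := hasJet_eulerOdd_pow.mul hasJet_eulerOdd_inv
  have h2 := hasJet_eulerOdd.mul hasJet_eulerOdd_pow_inv
  have h3 := (h1.mul (h1.mul h1)).add (((h2.mul (h2.mul h2)).pow_mul 7).const_mul (-1))
  exact h3.congr_list (by decide +kernel)

/-- The modular equation cleared of negative powers of the nome. -/
noncomputable def modNum (q : ℂ) : ℂ :=
  modSum q ^ 7 + 175 * q ^ 5 * modSum q ^ 5 - 667 * q ^ 4 * modSum q ^ 4 * modDiff q +
    783 * q ^ 3 * modSum q ^ 3 * modDiff q ^ 2 - 936 * q ^ 10 * modSum q ^ 3 -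
    261 * q ^ 2 * modSum q ^ 2 * modDiff q ^ 3 + 4176 * q ^ 9 * modSum q ^ 2 * modDiff q +
    29 * q * modSum q * modDiff q ^ 4 - 9280 * q ^ 8 * modSum q * modDiff q ^ 2 -
    6480 * q ^ 15 * modSum q - modDiff q ^ 5 + 7448 * q ^ 7 * modDiff q ^ 3 +
    9072 * q ^ 14 * modDiff q

lemma modNum_isBigO : modNum =O[𝓝 0] fun q => q ^ 18 := by
  have b := hasJet_modSum
  have a := hasJet_modDiff
  have b2 := b.mul b
  have b3 := b2.mul b
  have b4 := b3.mul b
  have b5 := b4.mul b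
  have a2 := a.mul a
  have a3 := a2.mul a
  have h := (b5.mul b2).add <| ((b5.pow_mul 5).const_mul 175).add <|
    (((b4.mul a).pow_mul 4).const_mul (-667)).add <|
    (((b3.mul a2).pow_mul 3).const_mul 783).add <|
    ((b3.pow_mul 10).const_mul (-936)).add <|
    (((b2.mul a3).pow_mul 2).const_mul (-261)).add <|
    (((b2.mul a).pow_mul 9).const_mul 4176).add <|
    (((b.mul (a3.mul a)).pow_mul 1).const_mul 29).add <|
    (((b.mul a2).pow_mul 8).const_mul (-9280)).add <|
    ((b.pow_mul 15).const_mul (-6480)).add <|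
    ((a3.mul a2).const_mul (-1)).add <|
    ((a3.pow_mul 7).const_mul 7448).add ((a.pow_mul 14).const_mul 9072)
  refine Asymptotics.IsBigO.congr_left h fun q => ?_
  rw [evalList_eq_zero (by decide +kernel), modNum]
  push_cast
  ring

lemma nome_twentynine_mul (z : ℂ) : nome (29 * z) = nome z ^ 29 := by
  rw [nome, nome, ← Complex.exp_nat_mul]; congr 1; push_cast; ring

lemma modEqn_eq {z : ℂ} (hz : 0 < z.im) :
    modEqn z = cexp (-(2 * π * I * z * ((17 : ℕ) + 1 / 2))) * modNum (nome z) := by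
  obtain ⟨e, he⟩ : ∃ e, cexp (2 * π * I * z / 24) = e := ⟨_, rfl⟩
  have he0 : e ≠ 0 := he ▸ Complex.exp_ne_zero _
  have hn : nome z = e ^ 24 := by
    rw [nome, ← he, ← Complex.exp_nat_mul]; congr 1; push_cast; ring
  have hG : cexp (-(2 * π * I * z * ((17 : ℕ) + 1 / 2))) = (e ^ 420)⁻¹ := by
    rw [← he, ← Complex.exp_nat_mul, ← Complex.exp_neg]; congr 1; push_cast; ring
  have hu : weber z = e⁻¹ * eulerOdd (nome z) := by
    rw [weber_eq, ← he, Complex.exp_neg]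
  have hv : weber (29 * z) = (e ^ 29)⁻¹ * eulerOdd (nome z ^ 29) := by
    rw [weber_eq, ← he, ← Complex.exp_nat_mul, ← Complex.exp_neg, nome_twentynine_mul]
    congr 2; push_cast; ring
  have hp : eulerOdd (nome z) ≠ 0 := eulerOdd_ne_zero (nome_mem_ball hz)
  have hp2 : eulerOdd (nome z ^ 29) ≠ 0 := by
    rw [← nome_twentynine_mul]; exact eulerOdd_ne_zero (nome_mem_ball (im_29_mul_pos hz))
  have hB : modProd z + 4 / modProd z = (e ^ 60)⁻¹ * modSum (nome z) := by
    rw [modProd, modSum, hu, hv]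
    generalize eulerOdd (nome z) = p at *
    generalize eulerOdd (nome z ^ 29) = r at *
    rw [hn]; push_cast; field_simp
  have hA : modQuot z - 1 / modQuot z = (e ^ 84)⁻¹ * modDiff (nome z) := by
    rw [modQuot, modDiff, hu, hv]
    generalize eulerOdd (nome z) = p at *
    generalize eulerOdd (nome z ^ 29) = r at *
    rw [hn]; push_cast; field_simp; ring
  rw [modEqn, hB, hA, hG, modNum, modPoly]
  generalize modSum (nome z) = b
  generalize modDiff (nome z) = a
  rw [hn]; field_simp

/-- The modular equation of degree 29. -/
theorem modEqn_eq_zero {z : ℂ} (hz : 0 < z.im) : modEqn z = 0 := by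
  refine eq_zero_of_reduction (fun w hw => ?_) (fun w hw => norm_modEqn_add_one hw) ?_
    (c := 1 / 116) (by norm_num) (fun w hw => exists_modEqn_reduction hw) hz
  · have h1 := differentiableAt_weber hw
    have h2 : DifferentiableAt ℂ (fun w => weber (29 * w)) w :=
      (differentiableAt_weber (im_29_mul_pos hw)).comp w (differentiableAt_id.const_mul 29)
    have h3 : DifferentiableAt ℂ modProd w := (h1.mul h2).pow 2
    have h4 : DifferentiableAt ℂ modQuot w := (h2.div h1 (weber_ne_zero hw)).pow 3
    have h5 := h3.add ((differentiableAt_const (4 : ℂ)).div h3 (modProd_ne_zero hw))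
    have h6 := h4.sub ((differentiableAt_const (1 : ℂ)).div h4 (modQuot_ne_zero hw))
    have h7 : Differentiable ℂ fun x : ℂ × ℂ => modPoly x.1 x.2 := by
      unfold modPoly; fun_prop
    have h8 : modEqn = (fun x : ℂ × ℂ => modPoly x.1 x.2) ∘
        fun w => (modProd w + 4 / modProd w, modQuot w - 1 / modQuot w) := rfl
    rw [h8]
    exact DifferentiableAt.comp w h7.differentiableAt (h5.prodMk h6)
  · have hO : modNum =O[𝓝 0] fun q => q ^ (17 + 1) := by simpa using modNum_isBigO
    refine (tendsto_exp_mul_comp_nome hO).congr' ?_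
    have : ∀ᶠ w : ℂ in comap im atTop, 0 < w.im :=
      tendsto_comap.eventually (eventually_gt_atTop 0)
    filter_upwards [this] with w hw
    rw [modEqn_eq hw]

/-- The partial derivative of `modPoly` in the first variable. -/
def modPolyB (B A : ℂ) : ℂ :=
  7 * B ^ 6 + 875 * B ^ 4 - 2668 * B ^ 3 * A + 2349 * B ^ 2 * A ^ 2 - 2808 * B ^ 2 -
    522 * B * A ^ 3 + 8352 * B * A + 29 * A ^ 4 - 9280 * A ^ 2 - 6480

/-- The partial derivative of `modPoly` in the second variable. -/
def modPolyA (B A : ℂ) : ℂ :=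
  -667 * B ^ 4 + 1566 * B ^ 3 * A - 783 * B ^ 2 * A ^ 2 + 4176 * B ^ 2 + 116 * B * A ^ 3 -
    18560 * B * A - 5 * A ^ 4 + 22344 * A ^ 2 + 9072

lemma hasDerivAt_modPoly {b a : ℂ → ℂ} {b' a' z : ℂ} (hb : HasDerivAt b b' z)
    (ha : HasDerivAt a a' z) :
    HasDerivAt (fun z => modPoly (b z) (a z))
      (modPolyB (b z) (a z) * b' + modPolyA (b z) (a z) * a') z := by
  have h1 := (((((hb.pow 7).add ((hb.pow 5).const_mul 175)).sub
    (((hb.pow 4).const_mul 667).mul ha)).add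
    (((hb.pow 3).const_mul 783).mul (ha.pow 2))).sub ((hb.pow 3).const_mul 936)).sub
    (((hb.pow 2).const_mul 261).mul (ha.pow 3))
  have h2 := ((((((h1.add (((hb.pow 2).const_mul 4176).mul ha)).add
    ((hb.const_mul 29).mul (ha.pow 4))).sub ((hb.const_mul 9280).mul (ha.pow 2))).sub
    (hb.const_mul 6480)).sub (ha.pow 5)).add ((ha.pow 3).const_mul 7448)).add
    (ha.const_mul 9072)
  refine h2.congr_deriv ?_
  simp only [modPolyB, modPolyA, Pi.pow_apply]
  push_cast
  ring

lemma hasDerivAt_weber_mul {z : ℂ} (hz : 0 < z.im) :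
    HasDerivAt (fun z => weber (29 * z))
      (-(2 * π * I / 24) * (29 * dlogWeber (nome (29 * z))) * weber (29 * z)) z := by
  have h := (hasDerivAt_weber (im_29_mul_pos hz)).comp z ((hasDerivAt_id z).const_mul 29)
  exact h.congr_deriv (by ring)

lemma hasDerivAt_modProd {z : ℂ} (hz : 0 < z.im) :
    HasDerivAt modProd (-(2 * π * I / 12) *
      (dlogWeber (nome z) + 29 * dlogWeber (nome (29 * z))) * modProd z) z := by
  have h := ((hasDerivAt_weber hz).mul (hasDerivAt_weber_mul hz)).pow 2
  refine h.congr_deriv ?_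
  simp only [modProd, Pi.mul_apply]
  push_cast
  ring

lemma hasDerivAt_modQuot {z : ℂ} (hz : 0 < z.im) :
    HasDerivAt modQuot (-(2 * π * I / 8) *
      (29 * dlogWeber (nome (29 * z)) - dlogWeber (nome z)) * modQuot z) z := by
  have h0 := weber_ne_zero hz
  have h := ((hasDerivAt_weber_mul hz).div (hasDerivAt_weber hz) h0).pow 3
  refine h.congr_deriv ?_
  simp only [modQuot, Pi.div_apply]
  push_cast
  field_simp
  ring

lemma modEqn_deriv {z : ℂ} (hz : 0 < z.im) :
    2 * modPolyB (modProd z + 4 / modProd z) (modQuot z - 1 / modQuot z) *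
        (dlogWeber (nome z) + 29 * dlogWeber (nome (29 * z))) * (modProd z - 4 / modProd z) +
      3 * modPolyA (modProd z + 4 / modProd z) (modQuot z - 1 / modQuot z) *
        (29 * dlogWeber (nome (29 * z)) - dlogWeber (nome z)) * (modQuot z + 1 / modQuot z) =
      0 := by
  have hX := modProd_ne_zero hz
  have hR := modQuot_ne_zero hz
  have dX := hasDerivAt_modProd hz
  have dR := hasDerivAt_modQuot hz
  have h1 := hasDerivAt_modPoly (dX.add ((hasDerivAt_const z (4 : ℂ)).div dX hX))
    (dR.sub ((hasDerivAt_const z (1 : ℂ)).div dR hR))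
  have h2 : HasDerivAt (fun z => modPoly (modProd z + 4 / modProd z) (modQuot z - 1 / modQuot z))
      0 z := (hasDerivAt_const z (0 : ℂ)).congr_of_eventuallyEq
    ((eventually_im_pos hz).mono fun w hw => modEqn_eq_zero hw)
  have h3 := h2.unique h1
  simp only [Pi.add_apply, Pi.sub_apply, Pi.div_apply] at h3
  generalize modPolyB _ _ = g1 at *
  generalize modPolyA _ _ = g2 at *
  have h4 : (2 * π * I / 24 : ℂ) ≠ 0 := div_ne_zero two_pi_I_ne_zero (by norm_num)
  refine (mul_eq_zero.1 ?_).resolve_left h4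
  rw [← neg_eq_zero, h3]
  field_simp
  ring

/-- The quadratic point `i / √58`. -/
noncomputable def pt : ℂ := (1 / √58 : ℝ) * I

lemma pt_im : pt.im = 1 / √58 := by rw [pt, im_ofReal_mul, I_im, mul_one]

lemma pt_im_pos : 0 < pt.im := by rw [pt_im]; positivity

lemma pt_sq : pt ^ 2 = -1 / 58 := by
  rw [pt, mul_pow, I_sq, ← Complex.ofReal_pow, div_pow, Real.sq_sqrt (by norm_num)]
  push_cast; norm_num

lemma fricke_pt : -1 / (2 * pt) = 29 * pt := by
  have h := ne_zero_of_im_pos pt_im_pos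
  field_simp
  linear_combination (58 : ℂ) * -pt_sq

lemma weber_pt_mul : weber (29 * pt) * weber pt = (√2 : ℝ) := by
  have h := weber_fricke pt_im_pos
  rw [fricke_pt] at h
  rw [h, div_mul_cancel₀ _ (weber_ne_zero pt_im_pos)]

lemma modProd_pt : modProd pt = 2 := by
  rw [modProd, mul_comm (weber pt), weber_pt_mul, ← Complex.ofReal_pow, Real.sq_sqrt zero_le_two]
  simp

lemma dlogWeber_pt : dlogWeber (nome pt) = 29 * dlogWeber (nome (29 * pt)) := by
  have h := dlogWeber_fricke pt_im_pos
  rw [fricke_pt, pt_sq] at h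
  rw [h]; ring

lemma hasDerivAt_of_zero_mul {f g : ℂ → ℂ} {z d : ℂ} (hf : ContinuousAt f z)
    (hg : HasDerivAt g d z) (h0 : g z = 0) : HasDerivAt (fun w => f w * g w) (f z * d) z := by
  rw [hasDerivAt_iff_tendsto_slope] at hg ⊢
  refine ((hf.tendsto.mono_left nhdsWithin_le_nhds).mul hg).congr fun w => ?_
  simp only [slope, h0, vsub_eq_sub, smul_eq_mul, sub_zero, mul_zero]
  ring

/-- The second derivative of the modular equation at the quadratic point. -/
lemma modEqn_second_deriv :
    2 * modPolyB 4 (modQuot pt - 1 / modQuot pt) * (58 * dlogWeber (nome (29 * pt))) ^ 2 * 4 =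
      36 * modPolyA 4 (modQuot pt - 1 / modQuot pt) * (modQuot pt + 1 / modQuot pt) *
        (29 ^ 2 * (nome (29 * pt) * deriv dlogWeber (nome (29 * pt))) -
          nome pt * deriv dlogWeber (nome pt)) := by
  have hz := pt_im_pos
  have hX := modProd_ne_zero hz
  have hR := modQuot_ne_zero hz
  have dX := hasDerivAt_modProd hz
  have dR := hasDerivAt_modQuot hz
  have dU := hasDerivAt_comp_nome differentiableOn_dlogWeber hz
  have dV : HasDerivAt (fun z => dlogWeber (nome (29 * z))) _ pt :=
    (hasDerivAt_comp_nome differentiableOn_dlogWeber (im_29_mul_pos hz)).comp pt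
      ((hasDerivAt_id pt).const_mul 29)
  have cB : ContinuousAt (fun z => modProd z + 4 / modProd z) pt :=
    dX.continuousAt.add (continuousAt_const.div dX.continuousAt hX)
  have cA : ContinuousAt (fun z => modQuot z - 1 / modQuot z) pt :=
    dR.continuousAt.sub (continuousAt_const.div dR.continuousAt hR)
  have c1 : ContinuousAt (fun z => 2 *
      modPolyB (modProd z + 4 / modProd z) (modQuot z - 1 / modQuot z) *
        (dlogWeber (nome z) + 29 * dlogWeber (nome (29 * z)))) pt := by
    have h : Continuous fun x : ℂ × ℂ => modPolyB x.1 x.2 := by unfold modPolyB; fun_prop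
    exact (continuousAt_const.mul
      (ContinuousAt.comp (f := fun z => (modProd z + 4 / modProd z, modQuot z - 1 / modQuot z))
        h.continuousAt (cB.prodMk cA))).mul
      (dU.continuousAt.add (continuousAt_const.mul dV.continuousAt))
  have c2 : ContinuousAt (fun z => 3 *
      modPolyA (modProd z + 4 / modProd z) (modQuot z - 1 / modQuot z) *
        (modQuot z + 1 / modQuot z)) pt := by
    have h : Continuous fun x : ℂ × ℂ => modPolyA x.1 x.2 := by unfold modPolyA; fun_prop
    exact (continuousAt_const.mul
      (ContinuousAt.comp (f := fun z => (modProd z + 4 / modProd z, modQuot z - 1 / modQuot z))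
        h.continuousAt (cB.prodMk cA))).mul
      (dR.continuousAt.add (continuousAt_const.div dR.continuousAt hR))
  have h1 := hasDerivAt_of_zero_mul c1 (dX.sub ((hasDerivAt_const pt (4 : ℂ)).div dX hX))
    (by simp only [Pi.sub_apply, Pi.div_apply, modProd_pt]; norm_num)
  have h2 := hasDerivAt_of_zero_mul c2 ((dV.const_mul 29).sub dU)
    (by simp only [Pi.sub_apply, dlogWeber_pt]; ring)
  have h3 : HasDerivAt (fun _ => (0 : ℂ)) _ pt := (h1.add h2).congr_of_eventuallyEq
    ((eventually_im_pos hz).mono fun w hw => by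
      simp only [Pi.add_apply, Pi.sub_apply, Pi.div_apply]
      rw [← modEqn_deriv hw]; ring)
  have h4 := (hasDerivAt_const pt (0 : ℂ)).unique h3
  rw [modProd_pt, dlogWeber_pt, show (2 : ℂ) + 4 / 2 = 4 by norm_num] at h4
  have h5 : (2 * π * I / 12 : ℂ) ≠ 0 := div_ne_zero two_pi_I_ne_zero (by norm_num)
  generalize modPolyB _ _ = g1 at *
  generalize modPolyA _ _ = g2 at *
  refine mul_left_cancel₀ h5 ?_
  linear_combination h4

lemma three_lt_im_pt : 3 < (29 * pt).im := by
  have h : √58 < 29 / 3 := by rw [Real.sqrt_lt' (by norm_num)]; norm_num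
  have h2 : (29 * pt).im = 29 / √58 := by
    rw [show (29 * pt).im = 29 * pt.im by simp, pt_im]; ring
  rw [h2, lt_div_iff₀ (by positivity)]
  linarith

lemma norm_nome_pt_lt : ‖nome (29 * pt)‖ < 1 / 1000 := by
  have h1 := three_lt_im_pt
  have h2 := Real.pi_gt_three
  have h3 : Real.exp (-(2 * π * (29 * pt).im)) ≤ Real.exp (-((10 : ℕ) * 1)) := by
    rw [Real.exp_le_exp]; push_cast; nlinarith
  rw [norm_nome]
  refine h3.trans_lt ?_
  rw [Real.exp_neg, Real.exp_nat_mul, inv_eq_one_div]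
  refine one_div_lt_one_div_of_lt (by norm_num) ?_
  calc (1000 : ℝ) < 2 ^ 10 := by norm_num
    _ ≤ Real.exp 1 ^ 10 := by gcongr; linarith [Real.add_one_le_exp 1]

lemma nome_pt_mem : nome (29 * pt) ∈ Metric.ball (0 : ℂ) (1 / 1000) :=
  mem_ball_zero_iff.2 norm_nome_pt_lt

lemma norm_weber_pt : 50 < ‖weber (29 * pt)‖ ^ 6 := by
  have h1 := three_lt_im_pt
  have h2 := Real.pi_gt_three
  have h3 := (norm_eulerOdd_bounds norm_nome_pt_lt.le).1
  have h4 : ‖cexp (-(2 * π * I * (29 * pt) / 24))‖ ^ 6 = Real.exp (π * (29 * pt).im / 2) := by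
    rw [Complex.norm_exp, ← Real.exp_nat_mul]
    congr 1
    generalize 29 * pt = w
    have : -(2 * π * I * w / 24) = ((-π / 12 : ℝ) : ℂ) * (I * w) := by push_cast; ring
    rw [this, re_ofReal_mul]
    simp; ring
  have h5 : Real.exp ((4 : ℕ) * 1) ≤ Real.exp (π * (29 * pt).im / 2) := by
    rw [Real.exp_le_exp]; push_cast; nlinarith
  rw [Real.exp_nat_mul] at h5
  rw [weber_eq, norm_mul, mul_pow, h4]
  have h6 := Real.exp_one_gt_d9
  calc (50 : ℝ) < 2.7182818283 ^ 4 * (899 / 900) ^ 6 := by norm_num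
    _ ≤ Real.exp 1 ^ 4 * (899 / 900) ^ 6 := by gcongr
    _ ≤ _ := by gcongr

lemma modQuot_pt_sq : modQuot pt ^ 2 = weber (29 * pt) ^ 12 / 8 := by
  have h0 := weber_ne_zero pt_im_pos
  have h1 := weber_ne_zero (im_29_mul_pos pt_im_pos)
  have h2 : weber (29 * pt) ^ 6 * weber pt ^ 6 = 8 := by
    have h3 : (√2 : ℝ) ^ 6 = 8 := by
      rw [show (√2 : ℝ) ^ 6 = ((√2) ^ 2) ^ 3 by ring, Real.sq_sqrt zero_le_two]; norm_num
    rw [← mul_pow, weber_pt_mul, ← Complex.ofReal_pow, h3]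
    simp
  rw [modQuot, ← h2]
  field_simp

lemma norm_modQuot_pt : 16 < ‖modQuot pt‖ := by
  have h1 := congrArg norm modQuot_pt_sq
  have h2 := norm_weber_pt
  rw [norm_div, norm_pow, norm_pow, show (12 : ℕ) = 6 * 2 from rfl, pow_mul] at h1
  simp only [Complex.norm_ofNat] at h1
  nlinarith [norm_nonneg (modQuot pt)]

lemma modQuot_pt_sub : modQuot pt - 1 / modQuot pt = 140 := by
  have h := modEqn_eq_zero pt_im_pos
  rw [modEqn, modProd_pt, show (2 : ℂ) + 4 / 2 = 4 by norm_num] at h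
  have hR := norm_modQuot_pt
  have hA : 15 < ‖modQuot pt - 1 / modQuot pt‖ := by
    have h1 := norm_sub_norm_le (modQuot pt) (1 / modQuot pt)
    have h2 : ‖1 / modQuot pt‖ < 1 := by
      rw [norm_div, norm_one, div_lt_one (by linarith)]; linarith
    linarith
  generalize modQuot pt - 1 / modQuot pt = A at *
  have h1 : (A - 140) * ((A - 2) ^ 2 * (A + 14) ^ 2) = 0 := by
    rw [modPoly] at h
    linear_combination -h
  rcases mul_eq_zero.1 h1 with h2 | h2
  · exact sub_eq_zero.1 h2
  exfalso
  rcases mul_eq_zero.1 h2 with h3 | h3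
  · rw [sub_eq_zero.1 (pow_eq_zero_iff two_ne_zero |>.1 h3)] at hA
    norm_num at hA
  · rw [eq_neg_of_add_eq_zero_left (pow_eq_zero_iff two_ne_zero |>.1 h3)] at hA
    norm_num at hA

lemma sqrt_29_sq : ((√29 : ℝ) : ℂ) ^ 2 = 29 := by
  rw [← Complex.ofReal_pow, Real.sq_sqrt (by norm_num)]; simp

lemma modQuot_pt : modQuot pt = 70 + 13 * (√29 : ℝ) := by
  have h := modQuot_pt_sub
  have hR := norm_modQuot_pt
  have h0 := modQuot_ne_zero pt_im_pos
  generalize modQuot pt = R at *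
  have h1 : (R - (70 + 13 * (√29 : ℝ))) * (R - (70 - 13 * (√29 : ℝ))) = 0 := by
    field_simp at h
    linear_combination h - 169 * sqrt_29_sq
  rcases mul_eq_zero.1 h1 with h2 | h2
  · exact sub_eq_zero.1 h2
  exfalso
  have h5 : √29 < 6 := by rw [Real.sqrt_lt' (by norm_num)]; norm_num
  have h6 : 5 < √29 := by rw [Real.lt_sqrt (by norm_num)]; norm_num
  have h3 : R = ((70 - 13 * √29 : ℝ) : ℂ) := by rw [sub_eq_zero.1 h2]; push_cast; ring
  rw [h3, Complex.norm_real, Real.norm_eq_abs] at hR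
  have : |70 - 13 * √29| ≤ 8 := by rw [abs_le]; constructor <;> linarith
  linarith

lemma modQuot_pt_add : modQuot pt + 1 / modQuot pt = 26 * (√29 : ℝ) := by
  linear_combination 2 * modQuot_pt - modQuot_pt_sub

lemma eulerOdd_pt_pow :
    eulerOdd (nome (29 * pt)) ^ 24 = nome (29 * pt) * (64 * modQuot pt ^ 4) := by
  have h1 : 64 * modQuot pt ^ 4 = weber (29 * pt) ^ 24 := by
    linear_combination 64 * (modQuot pt ^ 2 + weber (29 * pt) ^ 12 / 8) * modQuot_pt_sq
  rw [h1, weber_eq, mul_pow, ← mul_assoc, nome, ← Complex.exp_nat_mul, ← Complex.exp_add,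
    ← nome]
  push_cast
  rw [show 2 * π * I * (29 * pt) + 24 * -(2 * π * I * (29 * pt) / 24) = 0 by ring,
    Complex.exp_zero, one_mul]

lemma modQuot_pt_pow_add : modQuot pt ^ 4 + 1 = 19602 * modQuot pt ^ 2 := by
  have h := modQuot_pt_sub
  have h0 := modQuot_ne_zero pt_im_pos
  field_simp at h
  linear_combination (modQuot pt ^ 2 + 140 * modQuot pt - 1) * h

lemma modDen_pt : modDen (nome (29 * pt)) = nome (29 * pt) * (64 * (19602 * modQuot pt ^ 2)) := by
  rw [modDen, eulerOdd_pt_pow, ← modQuot_pt_pow_add]; ring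

lemma modX_pt : modX (nome (29 * pt)) = 1 / 396 ^ 4 := by
  have h0 := modQuot_ne_zero pt_im_pos
  have h1 := nome_ne_zero (29 * pt)
  rw [modX, modDen_pt, eulerOdd_pt_pow]
  field_simp
  norm_num

lemma modR_pt : modR (nome (29 * pt)) = 1820 * (√29 : ℝ) / 9801 := by
  have h0 := modQuot_ne_zero pt_im_pos
  have h1 := nome_ne_zero (29 * pt)
  have h2 : modQuot pt ^ 4 - 1 = 3640 * (√29 : ℝ) * modQuot pt ^ 2 := by
    rw [modQuot_pt]
    linear_combination (28561 * ((√29 : ℝ) : ℂ) ^ 2 - 827931) * sqrt_29_sq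
  rw [modR, modDen_pt, eulerOdd_pt_pow, show nome (29 * pt) * (64 * modQuot pt ^ 4) -
    64 * nome (29 * pt) = nome (29 * pt) * (64 * (modQuot pt ^ 4 - 1)) by ring, h2]
  field_simp
  norm_num

lemma dlogWeber_pt_ne_zero : dlogWeber (nome (29 * pt)) ≠ 0 := by
  have hq := nome_mem_ball (im_29_mul_pos pt_im_pos)
  intro h
  have h1 := dlogWeber_sq hq
  rw [h, zero_pow two_ne_zero, zero_mul] at h1
  exact mul_ne_zero (pow_ne_zero 4 (eulerMul_ne_zero hq)) (modDen_ne_zero nome_pt_mem) h1.symm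

lemma nome_mul_deriv_dlogWeber {q : ℂ} (hq : q ∈ Metric.ball (0 : ℂ) (1 / 1000)) :
    q * deriv dlogWeber q = dlogWeber q * modR q * hyper 1 (modX q) :=
  ((hasEulerDeriv_hyper 0 hq).congr_fun (Filter.mem_of_superset (Metric.isOpen_ball.mem_nhds hq)
    fun _ hw => dlogWeber_eq_hyper hw)).mul_deriv

lemma fricke_mul_pt : -1 / (2 * (29 * pt)) = pt := by
  have h := ne_zero_of_im_pos pt_im_pos
  field_simp
  linear_combination (58 : ℂ) * -pt_sq

lemma pt_eq : pt = I / ((√2 : ℝ) * (√29 : ℝ)) := by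
  rw [pt, show (58 : ℝ) = 2 * 29 by norm_num, Real.sqrt_mul zero_le_two]
  push_cast; ring

lemma hyper_pt :
    26390 * hyper 1 (1 / 396 ^ 4) + 1103 * hyper 0 (1 / 396 ^ 4) =
      9801 / (2 * (√2 : ℝ) * π) := by
  have h1 := modEqn_second_deriv
  have h2 := nome_deriv_dlogWeber_fricke (im_29_mul_pos pt_im_pos)
  rw [fricke_mul_pt] at h2
  rw [h2, modQuot_pt_sub, modQuot_pt_add, nome_mul_deriv_dlogWeber nome_pt_mem, modX_pt,
    modR_pt] at h1
  have h3 := dlogWeber_pt_ne_zero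
  have h4 := dlogWeber_eq_hyper nome_pt_mem
  rw [modX_pt] at h4
  rw [← h4]
  generalize hyper 1 (1 / 396 ^ 4) = a at *
  generalize dlogWeber (nome (29 * pt)) = Z at *
  have hs := sqrt_29_sq
  have hπ : (π : ℂ) ≠ 0 := by simp [Real.pi_ne_zero]
  have ht : ((√2 : ℝ) : ℂ) ≠ 0 := by simp
  have hs0 : ((√29 : ℝ) : ℂ) ≠ 0 := by simp
  have hB : modPolyB 4 140 = 5946899504 := by rw [modPolyB]; norm_num
  have hA : modPolyA 4 140 = -451647504 := by rw [modPolyA]; norm_num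
  have h5 : 8 * (29 * pt) ^ 3 * Z / (2 * π * I) =
      -(1682 * Z) / ((√2 : ℝ) * (√29 : ℝ) * π) := by
    rw [show 8 * (29 * pt) ^ 3 = 8 * 29 ^ 3 * (pt ^ 2 * pt) by ring, pt_sq, pt_eq]
    have := I_ne_zero
    field_simp
    norm_num
  rw [hA, hB, h5, show (29 * pt) ^ 4 = 29 ^ 4 * (pt ^ 2) ^ 2 by ring, pt_sq] at h1
  generalize ((√29 : ℝ) : ℂ) = s at *
  generalize ((√2 : ℝ) : ℂ) = t at *
  field_simp at h1 ⊢
  rw [hs] at h1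
  linear_combination (2206 / (2 * 5946899504 * 58 ^ 4 * 4 * 9801)) * h1

lemma hasSum_ramanujan :
    HasSum (fun n : ℕ => (26390 * (n : ℂ) + 1103) * coef n * (1 / 396 ^ 4) ^ n)
      (9801 / (2 * (√2 : ℝ) * π) : ℂ) := by
  have hx : ‖(1 / 396 ^ 4 : ℂ)‖ < 1 / 256 := by norm_num
  have h := ((summable_hyper 1 hx).hasSum.mul_left 26390).add
    ((summable_hyper 0 hx).hasSum.mul_left 1103)
  rw [← hyper_pt]
  have e : (fun n : ℕ => (26390 * (n : ℂ) + 1103) * coef n * (1 / 396 ^ 4) ^ n) = fun n : ℕ =>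
      26390 * ((n : ℂ) ^ 1 * coef n * (1 / 396 ^ 4) ^ n) +
        1103 * ((n : ℂ) ^ 0 * coef n * (1 / 396 ^ 4) ^ n) := by
    funext n; ring
  rw [e]
  exact h

end RamanujanPi

open Real

/-- Ramanujan's series for `1/π`:
`1/π = (2√2/9801) · ∑_{n=0}^∞ (26390n + 1103) · (4n)! / ((n!)^4 · 396^(4n))`. -/
theorem ramanujan_series_for_one_over_pi :
    1 / π = (2 * Real.sqrt 2 / 9801) *
      ∑' n : ℕ, (26390 * (n : ℝ) + 1103) * (Nat.factorial (4 * n) : ℝ) /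
        ((Nat.factorial n : ℝ) ^ 4 * 396 ^ (4 * n)) := by
  have h : HasSum (fun n : ℕ => (26390 * (n : ℝ) + 1103) *
      (Nat.factorial (4 * n) : ℝ) / ((Nat.factorial n : ℝ) ^ 4 * 396 ^ (4 * n)))
      (9801 / (2 * √2 * π)) := by
    rw [← Complex.hasSum_ofReal]
    push_cast
    convert RamanujanPi.hasSum_ramanujan using 2 with n
    rw [RamanujanPi.coef, one_div, inv_pow, ← pow_mul]
    ring
  rw [h.tsum_eq]
  field_simp
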